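/- arXiv:1112.6061 — 8 statements merged into one kernel-verified Lean document; each statement's English description precedes it below -/
import Mathlib

section
/- Given positive integers m and k, there is a unique way to pick an integer s ≥ 0 and integers n_k > n_{k-1} > ... > n_{k-s} with n_{k-s} ≥ k-s > 0 such that m = C(n_k, k) + C(n_{k-1}, k-1) + ... + C(n_{k-s}, k-s), where C(a,b) denotes the binomial coefficient. -/
/-- `n 0 > n 1 > ⋯ > n s` gives a cascade representation of `m` with respect to `k`, where `n i`
is the upper entry of the binomial coefficient with lower entry `k - i`. -/
structure IsCascade (m k s : ℕ) (n : ℕ → ℕ) : Prop where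
  eq_sum : m = ∑ i ∈ Finset.range (s + 1), Nat.choose (n i) (k - i)
  lt_of_lt : ∀ i j, i < j → j ≤ s → n j < n i
  le_last : k - s ≤ n s
  lt : s < k

namespace IsCascade

variable {m k s a : ℕ} {n : ℕ → ℕ}

theorem pos (h : IsCascade m k s n) : 0 < m := by
  rw [h.eq_sum]
  exact (Nat.choose_pos h.le_last).trans_le
    (Finset.single_le_sum (f := fun i => (n i).choose (k - i)) (fun _ _ => Nat.zero_le _)
      (Finset.self_mem_range_succ s))

theorem choose_le (h : IsCascade m k s n) : (n 0).choose k ≤ m := by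
  rw [h.eq_sum, Finset.sum_range_succ']
  simp

/-- Dropping the leading term of a cascade with at least two terms. -/
theorem tail (h : IsCascade m (k + 1) (s + 1) n) :
    ∃ r, m = r + (n 0).choose (k + 1) ∧ IsCascade r k s (fun i => n (i + 1)) := by
  refine ⟨∑ i ∈ Finset.range (s + 1), (n (i + 1)).choose (k - i), ?_, rfl, ?_, ?_, ?_⟩
  · rw [h.eq_sum, Finset.sum_range_succ']
    simp
  · exact fun i j hij hj => h.lt_of_lt _ _ (by lia) (by lia)
  · simpa using h.le_last
  · simpa using h.lt

/-- Prepending a leading term to a cascade. -/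
theorem cons (h : IsCascade m k s n) (ha : n 0 < a) :
    IsCascade (m + a.choose (k + 1)) (k + 1) (s + 1) (fun i => Nat.casesOn i a n) where
  eq_sum := by
    rw [h.eq_sum, Finset.sum_range_succ' _ (s + 1)]
    simp
  lt_of_lt := by
    rintro (_ | i) (_ | j) hij hj
    · lia
    · rcases Nat.eq_zero_or_pos j with rfl | hj0
      · exact ha
      · exact (h.lt_of_lt 0 j hj0 (by lia)).trans ha
    · lia
    · exact h.lt_of_lt i j (by lia) (by lia)
  le_last := by simpa using h.le_last
  lt := by simpa using h.lt

theorem lt_choose (h : IsCascade m k s n) : m < (n 0 + 1).choose k := by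
  induction s generalizing m k n with
  | zero =>
    obtain ⟨k, rfl⟩ := Nat.exists_eq_add_of_lt h.lt
    have hm := h.eq_sum
    have hk := h.le_last
    simp only [zero_add, Finset.sum_range_one, Nat.sub_zero] at hm hk ⊢
    have := Nat.choose_pos (n := n 0) (k := k) (by lia)
    rw [Nat.choose_succ_succ']
    lia
  | succ s ih =>
    obtain ⟨k, rfl⟩ := Nat.exists_eq_succ_of_ne_zero (Nat.ne_zero_of_lt h.lt)
    obtain ⟨r, rfl, hr⟩ := h.tail
    have h1 := ih hr
    have h2 := Nat.choose_le_choose k (h.lt_of_lt 0 1 one_pos (by lia) : n 1 + 1 ≤ n 0)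
    rw [Nat.succ_eq_add_one, Nat.choose_succ_succ']
    simp only [zero_add] at h1
    lia

theorem head_le {s' : ℕ} {n' : ℕ → ℕ} (h : IsCascade m k s n) (h' : IsCascade m k s' n') :
    n 0 ≤ n' 0 := by
  by_contra! hlt
  have := Nat.choose_le_choose k (show n' 0 + 1 ≤ n 0 from hlt)
  have := h.choose_le
  have := h'.lt_choose
  lia

theorem unique {s' : ℕ} {n' : ℕ → ℕ} (h : IsCascade m k s n) (h' : IsCascade m k s' n') :
    s' = s ∧ ∀ i ≤ s, n' i = n i := by
  have h0 : n' 0 = n 0 := le_antisymm (h'.head_le h) (h.head_le h')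
  induction s generalizing m k n s' n' with
  | zero =>
    obtain _ | s' := s'
    · simpa using h0
    · obtain ⟨k, rfl⟩ := Nat.exists_eq_succ_of_ne_zero (Nat.ne_zero_of_lt h.lt)
      obtain ⟨r, hr, hc⟩ := h'.tail
      have := hc.pos
      have hm := h.eq_sum
      simp only [zero_add, Finset.sum_range_one, Nat.sub_zero, Nat.succ_eq_add_one] at hm
      rw [h0] at hr
      lia
  | succ s ih =>
    obtain ⟨k, rfl⟩ := Nat.exists_eq_succ_of_ne_zero (Nat.ne_zero_of_lt h.lt)
    obtain ⟨r, hr, hc⟩ := h.tail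
    obtain _ | s' := s'
    · have := hc.pos
      have hm := h'.eq_sum
      simp only [zero_add, Finset.sum_range_one, Nat.sub_zero, Nat.succ_eq_add_one] at hm
      rw [h0] at hm
      lia
    · obtain ⟨r', hr', hc'⟩ := h'.tail
      rw [h0] at hr'
      obtain rfl : r' = r := by lia
      obtain ⟨rfl, hn⟩ := ih hc hc' (le_antisymm (hc'.head_le hc) (hc.head_le hc'))
      refine ⟨rfl, ?_⟩
      rintro (_ | i) hi
      · exact h0
      · exact hn i (by lia)

end IsCascade

theorem Nat.exists_lt_choose_succ (m k : ℕ) : ∃ n : ℕ, m < (n + 1).choose (k + 1) := by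
  induction m with
  | zero => exact ⟨k, by simp⟩
  | succ m ih =>
    obtain ⟨n, hn⟩ := ih
    have hk : k + 1 ≤ n + 1 := by
      by_contra! h
      rw [Nat.choose_eq_zero_of_lt h] at hn
      lia
    have := Nat.choose_pos (n := n + 1) (k := k) (by lia)
    refine ⟨n + 1, ?_⟩
    rw [Nat.choose_succ_succ']
    lia

theorem Nat.exists_choose_le_lt_choose_succ (m k : ℕ) :
    ∃ n : ℕ, n.choose (k + 1) ≤ m ∧ m < (n + 1).choose (k + 1) := by
  classical
  have hex := Nat.exists_lt_choose_succ m k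
  refine ⟨Nat.find hex, ?_, Nat.find_spec hex⟩
  rcases h : Nat.find hex with _ | n
  · simp
  · exact not_lt.mp (Nat.find_min hex (by lia))

theorem exists_isCascade {m : ℕ} (k : ℕ) (hm : 0 < m) : ∃ s n, IsCascade m (k + 1) s n := by
  induction k generalizing m with
  | zero => exact ⟨0, fun _ => m, by simp, by lia, by simpa using Nat.succ_le_of_lt hm, one_pos⟩
  | succ k ih =>
    obtain ⟨a, ha, ha'⟩ := Nat.exists_choose_le_lt_choose_succ m (k + 1)
    rw [Nat.choose_succ_succ'] at ha'
    rcases ha.eq_or_lt with heq | hlt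
    · refine ⟨0, fun _ => a, by simp [heq], by lia, ?_, by lia⟩
      by_contra! h
      rw [Nat.choose_eq_zero_of_lt (by simpa using h)] at heq
      lia
    · obtain ⟨s, n, h⟩ := ih (Nat.sub_pos_of_lt hlt)
      have hn : n 0 < a := by
        by_contra! hle
        have := Nat.choose_le_choose (k + 1) hle
        have := h.choose_le
        lia
      have := h.cons hn
      rw [Nat.sub_add_cancel ha] at this
      exact ⟨_, _, this⟩

/-- Given positive integers `m` and `k`, there is a unique way to pick an
integer `s ≥ 0` and integers `n_k > n_{k-1} > ⋯ > n_{k-s}` with `n_{k-s} ≥ k-s > 0` such that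
`m = C(n_k, k) + C(n_{k-1}, k-1) + ⋯ + C(n_{k-s}, k-s)`.
Here `n i` denotes `n_{k-i}` for `0 ≤ i ≤ s`. -/
theorem stmt_0 (m k : ℕ) (hm : 0 < m) (hk : 0 < k) :
    ∃ (s : ℕ) (n : ℕ → ℕ),
      (m = ∑ i ∈ Finset.range (s + 1), Nat.choose (n i) (k - i)) ∧
      (∀ i j, i < j → j ≤ s → n j < n i) ∧
      (k - s ≤ n s) ∧ (s < k) ∧
      (∀ (s' : ℕ) (n' : ℕ → ℕ),
        (m = ∑ i ∈ Finset.range (s' + 1), Nat.choose (n' i) (k - i)) →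
        (∀ i j, i < j → j ≤ s' → n' j < n' i) →
        (k - s' ≤ n' s') → (s' < k) →
        s' = s ∧ ∀ i ≤ s, n' i = n i) := by
  obtain ⟨k, rfl⟩ := Nat.exists_eq_succ_of_ne_zero hk.ne'
  obtain ⟨s, n, h⟩ := exists_isCascade k hm
  exact ⟨s, n, h.eq_sum, h.lt_of_lt, h.le_last, h.lt,
    fun _ _ h₁ h₂ h₃ h₄ => h.unique ⟨h₁, h₂, h₃, h₄⟩⟩
end

section
/- Let k ≥ 2 and q > 0 be integers. Then there are unique integers a, b, and m such that q = C(a, k) + C(b, k-1) + m, with a > b and C(b, k-2) > m ≥ 0. -/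
theorem lt_choose_add_succ (n j : ℕ) : n < Nat.choose (n + (j + 1)) (j + 1) := by
  induction n with
  | zero => simp
  | succ n ih =>
    have h : Nat.choose (n + 1 + (j + 1)) (j + 1)
        = Nat.choose (n + (j + 1)) j + Nat.choose (n + (j + 1)) (j + 1) := by
      rw [Nat.add_right_comm, Nat.choose_succ_succ']
    have hpos : 0 < Nat.choose (n + (j + 1)) j := Nat.choose_pos (by omega)
    omega

theorem exists_choose_le_lt_choose_succ (n j : ℕ) :
    ∃ a, Nat.choose a (j + 1) ≤ n ∧ n < Nat.choose (a + 1) (j + 1) := by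
  classical
  have hex : ∃ a, n < Nat.choose a (j + 1) := ⟨_, lt_choose_add_succ n j⟩
  obtain ⟨a, ha⟩ : ∃ a, Nat.find hex = a + 1 := by
    refine Nat.exists_eq_succ_of_ne_zero fun h => ?_
    have := Nat.find_spec hex
    simp [h] at this
  refine ⟨a, not_lt.mp (Nat.find_min hex (by omega)), ?_⟩
  rw [← ha]
  exact Nat.find_spec hex

theorem eq_of_choose_le_lt_choose_succ {n j a b : ℕ}
    (ha : Nat.choose a j ≤ n) (ha' : n < Nat.choose (a + 1) j)
    (hb : Nat.choose b j ≤ n) (hb' : n < Nat.choose (b + 1) j) : a = b := by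
  rcases lt_trichotomy a b with h | h | h
  · have := Nat.choose_le_choose j (show a + 1 ≤ b from h)
    omega
  · exact h
  · have := Nat.choose_le_choose j (show b + 1 ≤ a from h)
    omega

/-- Let `k ≥ 2` and `q > 0` be integers.  Then there are unique integers
`a`, `b`, and `m` such that `q = C(a, k) + C(b, k-1) + m`, with `a > b` and
`C(b, k-2) > m ≥ 0`. -/
theorem stmt_1 (k q : ℕ) (hk : 2 ≤ k) (hq : 0 < q) :
    ∃! abm : ℕ × ℕ × ℕ,
      q = Nat.choose abm.1 k + Nat.choose abm.2.1 (k - 1) + abm.2.2 ∧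
      abm.2.1 < abm.1 ∧ abm.2.2 < Nat.choose abm.2.1 (k - 2) := by
  obtain ⟨j, rfl⟩ := Nat.exists_eq_add_of_le' hk
  rw [show j + 2 - 1 = j + 1 from rfl, show j + 2 - 2 = j from rfl]
  obtain ⟨a, ha, ha'⟩ := exists_choose_le_lt_choose_succ q (j + 1)
  obtain ⟨b, hb, hb'⟩ := exists_choose_le_lt_choose_succ (q - Nat.choose a (j + 2)) j
  have pascal_a := Nat.choose_succ_succ' a (j + 1)
  have pascal_b := Nat.choose_succ_succ' b j
  simp only [add_assoc, Nat.reduceAdd] at ha ha' pascal_a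
  refine ⟨(a, b, q - Nat.choose a (j + 2) - Nat.choose b (j + 1)),
    ⟨?_, ?_, ?_⟩, ?_⟩
  · dsimp only
    omega
  · dsimp only
    by_contra! h
    have := Nat.choose_le_choose (j + 1) h
    omega
  · dsimp only
    omega
  · rintro ⟨c, d, m⟩ ⟨hsum, hdc, hm⟩
    dsimp only at hsum hdc hm
    have pascal_c := Nat.choose_succ_succ' c (j + 1)
    have pascal_d := Nat.choose_succ_succ' d j
    simp only [add_assoc, Nat.reduceAdd] at pascal_c
    have hle := Nat.choose_le_choose (j + 1) (show d + 1 ≤ c from hdc)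
    obtain rfl : c = a :=
      eq_of_choose_le_lt_choose_succ (n := q) (j := j + 2) (by omega) (by omega) ha ha'
    obtain rfl : d = b :=
      eq_of_choose_le_lt_choose_succ (n := q - Nat.choose c (j + 2)) (j := j + 1)
        (by omega) (by omega) hb hb'
    obtain rfl : m = q - Nat.choose c (j + 2) - Nat.choose d (j + 1) := by omega
    rfl
end

section
/- Let s ≥ k > p > 0 be integers. Then s^(k-p) · (s-k)^p ≤ (s-p)^k. -/
/-- Weighted AM-GM for two numbers with natural number weights. -/
theorem pow_mul_pow_le_weighted_mean_pow {m n : ℕ} (h : 0 < m + n) {a b : ℝ}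
    (ha : 0 ≤ a) (hb : 0 ≤ b) :
    a ^ m * b ^ n ≤ ((m * a + n * b) / (m + n)) ^ (m + n) := by
  have hmn : (0 : ℝ) < m + n := by exact_mod_cast h
  have key := Real.geom_mean_le_arith_mean2_weighted (w₁ := m / (m + n)) (w₂ := n / (m + n))
    (by positivity) (by positivity) ha hb (by field_simp)
  have root_pow (x : ℝ) (hx : 0 ≤ x) (l : ℕ) :
      (x ^ ((l : ℝ) / (m + n))) ^ (m + n) = x ^ l := by
    rw [← Real.rpow_mul_natCast hx, Nat.cast_add, div_mul_cancel₀ _ hmn.ne', Real.rpow_natCast]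
  calc a ^ m * b ^ n
      = (a ^ ((m : ℝ) / (m + n)) * b ^ ((n : ℝ) / (m + n))) ^ (m + n) := by
        rw [mul_pow, root_pow a ha, root_pow b hb]
    _ ≤ (m / (m + n) * a + n / (m + n) * b) ^ (m + n) :=
        pow_le_pow_left₀ (by positivity) key _
    _ = ((m * a + n * b) / (m + n)) ^ (m + n) := by
        congr 1
        ring

/-- Let `s ≥ k > p > 0` be integers.  Then
`s^(k-p) · (s-k)^p ≤ (s-p)^k`. -/
theorem stmt_2 (s k p : ℕ) (hp : 0 < p) (hpk : p < k) (hks : k ≤ s) :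
    s ^ (k - p) * (s - k) ^ p ≤ (s - p) ^ k := by
  obtain ⟨m, rfl⟩ := Nat.exists_eq_add_of_le' hpk.le
  obtain ⟨t, rfl⟩ := Nat.exists_eq_add_of_le' hks
  have h := pow_mul_pow_le_weighted_mean_pow (m := m) (n := p) (by omega)
    (a := (t + (m + p) : ℕ)) (b := t) (by positivity) (by positivity)
  have hmp : (m + p : ℝ) ≠ 0 := by positivity
  have hmean : ((m * (t + (m + p) : ℕ) + p * t) / (m + p) : ℝ) = (t + m : ℕ) := by
    push_cast
    field_simp
    ring
  rw [hmean] at h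
  rw [Nat.add_sub_cancel, Nat.add_sub_cancel, ← add_assoc t m p, Nat.add_sub_cancel, add_assoc]
  exact_mod_cast h
end

section
/- Let n ≥ k > p > 0 be integers. Then C(n,p)^k ≤ C(n,k)^p · C(k,p)^k. -/
/-- For a nonnegative nondecreasing sequence, the geometric mean of the first `p` terms is at most
that of the first `k ≥ p` terms. -/
theorem prod_range_pow_le_prod_range_pow {r : ℕ → ℚ} {p k : ℕ} (hpk : p < k)
    (hr : ∀ i, 0 ≤ r i) (hmono : MonotoneOn r (Set.Iio k)) :
    (∏ i ∈ Finset.range p, r i) ^ k ≤ (∏ i ∈ Finset.range k, r i) ^ p := by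
  have hhead : ∏ i ∈ Finset.range p, r i ≤ r p ^ p := by
    calc ∏ i ∈ Finset.range p, r i ≤ ∏ _i ∈ Finset.range p, r p := by
          refine Finset.prod_le_prod (fun i _ => hr i) fun i hi => ?_
          have hi := Finset.mem_range.mp hi
          exact hmono (hi.trans hpk) hpk hi.le
      _ = r p ^ p := by simp
  have htail : r p ^ (k - p) ≤ ∏ i ∈ Finset.Ico p k, r i := by
    calc r p ^ (k - p) = ∏ _i ∈ Finset.Ico p k, r p := by simp
      _ ≤ ∏ i ∈ Finset.Ico p k, r i := by
          refine Finset.prod_le_prod (fun i _ => hr p) fun i hi => ?_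
          have hi := Finset.mem_Ico.mp hi
          exact hmono hpk hi.2 hi.1
  have hnonneg : 0 ≤ ∏ i ∈ Finset.range p, r i := Finset.prod_nonneg fun i _ => hr i
  calc (∏ i ∈ Finset.range p, r i) ^ k
      = (∏ i ∈ Finset.range p, r i) ^ p * (∏ i ∈ Finset.range p, r i) ^ (k - p) := by
        rw [← pow_add, Nat.add_sub_cancel' hpk.le]
    _ ≤ (∏ i ∈ Finset.range p, r i) ^ p * (r p ^ p) ^ (k - p) := by gcongr
    _ = (∏ i ∈ Finset.range p, r i) ^ p * (r p ^ (k - p)) ^ p := by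
        rw [pow_right_comm]
    _ ≤ (∏ i ∈ Finset.range p, r i) ^ p * (∏ i ∈ Finset.Ico p k, r i) ^ p := by
        have := pow_nonneg (hr p) (k - p)
        gcongr
    _ = (∏ i ∈ Finset.range k, r i) ^ p := by
        rw [← mul_pow, Finset.prod_range_mul_prod_Ico r hpk.le]

theorem prod_range_sub_div_sub (n k m : ℕ) :
    ∏ i ∈ Finset.range m, (((n - i : ℕ) : ℚ) / ((k - i : ℕ) : ℚ)) =
      (n.choose m : ℚ) / (k.choose m : ℚ) := by
  have hfac : (m.factorial : ℚ) ≠ 0 := by positivity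
  rw [Finset.prod_div_distrib, ← Nat.cast_prod, ← Nat.cast_prod,
    ← Nat.descFactorial_eq_prod_range, ← Nat.descFactorial_eq_prod_range,
    Nat.descFactorial_eq_factorial_mul_choose, Nat.descFactorial_eq_factorial_mul_choose,
    Nat.cast_mul, Nat.cast_mul, mul_div_mul_left _ _ hfac]

theorem monotoneOn_sub_div_sub {n k : ℕ} (hkn : k ≤ n) :
    MonotoneOn (fun i : ℕ => ((n - i : ℕ) : ℚ) / ((k - i : ℕ) : ℚ)) (Set.Iio k) := by
  intro i hi j hj hij
  have hi : i < k := hi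
  have hj : j < k := hj
  have hik : (i : ℚ) < k := by exact_mod_cast hi
  have hjk : (j : ℚ) < k := by exact_mod_cast hj
  have hkn' : (k : ℚ) ≤ n := by exact_mod_cast hkn
  have hij' : (i : ℚ) ≤ j := by exact_mod_cast hij
  simp only
  rw [Nat.cast_sub (by omega), Nat.cast_sub (by omega), Nat.cast_sub (by omega),
    Nat.cast_sub (by omega), div_le_div_iff₀ (by linarith) (by linarith)]
  nlinarith [mul_nonneg (sub_nonneg.mpr hkn') (sub_nonneg.mpr hij')]

/-- Let `n ≥ k > p > 0` be integers.  Then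
`C(n,p)^k ≤ C(n,k)^p · C(k,p)^k`. -/
theorem stmt_3 (n k p : ℕ) (hp : 0 < p) (hpk : p < k) (hkn : k ≤ n) :
    Nat.choose n p ^ k ≤ Nat.choose n k ^ p * Nat.choose k p ^ k := by
  have h := prod_range_pow_le_prod_range_pow hpk (fun i => by positivity)
    (monotoneOn_sub_div_sub hkn)
  have hpos : (0 : ℚ) < k.choose p := by exact_mod_cast Nat.choose_pos hpk.le
  rw [prod_range_sub_div_sub, prod_range_sub_div_sub, Nat.choose_self, Nat.cast_one, div_one,
    div_pow, div_le_iff₀ (pow_pos hpos k)] at h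
  exact_mod_cast h
end

section
/- Let k > p > 1 be integers. Then the limit as m → ∞ of c_p^k(m) / m^((p-1)/(k-1)) exists and equals ((k-1)!)^((p-1)/(k-1)) / (p-1)!. -/
/-- `gk k m` : for `m > 0` and `k > 1`, the unique `n` with
`C(n, k-1) ≤ m < C(n+1, k-1)`. -/
def gk (k m : ℕ) : ℕ := Nat.findGreatest (fun n => Nat.choose n (k - 1) ≤ m) (m + k)

/-- The function `c_p^k`, defined recursively by `c_p^k(0) = 0` and
`c_p^k(m) = C(g_k(m), p-1) + c_p^k(m - C(g_k(m), k-1))` for `m > 0`. -/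
def cpk (p k : ℕ) : ℕ → ℕ
  | 0 => 0
  | m + 1 =>
    Nat.choose (gk k (m + 1)) (p - 1) + cpk p k (m + 1 - Nat.choose (gk k (m + 1)) (k - 1))
decreasing_by
  have h1 : k - 1 ≤ gk k (m + 1) :=
    Nat.le_findGreatest (by omega) (by simp [Nat.choose_self])
  have h2 : 0 < Nat.choose (gk k (m + 1)) (k - 1) := Nat.choose_pos h1
  omega

theorem Nat.lt_choose_add_self (m : ℕ) {r : ℕ} (hr : 0 < r) : m < (m + r).choose r := by
  induction m with
  | zero => simp
  | succ m ih =>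
    obtain ⟨r, rfl⟩ : ∃ q, r = q + 1 := ⟨r - 1, by omega⟩
    have h : (m + 1 + (r + 1)).choose (r + 1)
        = (m + (r + 1)).choose r + (m + (r + 1)).choose (r + 1) := by
      rw [show m + 1 + (r + 1) = (m + (r + 1)) + 1 by ring, Nat.choose_succ_succ]
    have h' : 0 < (m + (r + 1)).choose r := Nat.choose_pos (by omega)
    omega

theorem Nat.pow_le_mul_choose {n r : ℕ} (hr : 0 < r) (hn : r ≤ n) :
    n ^ r ≤ r ^ r * r.factorial * n.choose r := by
  have h1 : n ≤ r * (n + 1 - r) := by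
    obtain ⟨t, rfl⟩ := Nat.exists_eq_add_of_le hn
    rw [show r + t + 1 - r = t + 1 by omega]
    nlinarith
  calc n ^ r ≤ (r * (n + 1 - r)) ^ r := Nat.pow_le_pow_left h1 r
    _ = r ^ r * (n + 1 - r) ^ r := mul_pow ..
    _ ≤ r ^ r * (r.factorial * n.choose r) := by
      gcongr
      rw [← Nat.descFactorial_eq_factorial_mul_choose]
      exact Nat.pow_sub_le_descFactorial n r
    _ = _ := by ring

theorem Nat.choose_le_choose_mul_choose {n r s : ℕ} (hs : s ≤ r) (hn : r ≤ n) :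
    n.choose s ≤ r.choose s * n.choose r := by
  rw [mul_comm, Nat.choose_mul hs]
  exact Nat.le_mul_of_pos_right _ (Nat.choose_pos (by omega))

section

variable {r s m : ℕ}

theorem choose_gk_le (hr : 0 < r) (m : ℕ) : (gk (r + 1) m).choose r ≤ m := by
  have h := Nat.findGreatest_spec (P := fun n => Nat.choose n (r + 1 - 1) ≤ m)
    (Nat.zero_le (m + (r + 1))) (by simp [Nat.choose_eq_zero_of_lt hr])
  simpa [gk] using h

theorem le_gk {n : ℕ} (hn : n ≤ m + (r + 1)) (h : n.choose r ≤ m) : n ≤ gk (r + 1) m :=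
  Nat.le_findGreatest hn (by simpa using h)

theorem lt_choose_gk_succ (hr : 0 < r) (m : ℕ) : m < (gk (r + 1) m + 1).choose r := by
  by_contra! h
  have hle : gk (r + 1) m + 1 ≤ m + (r + 1) := by
    by_contra! h'
    have := Nat.lt_choose_add_self m hr
    have := Nat.choose_le_choose r (show m + r ≤ gk (r + 1) m + 1 by omega)
    omega
  have := le_gk hle h
  omega

theorem le_gk_of_pos (hm : 0 < m) : r ≤ gk (r + 1) m :=
  le_gk (by omega) (by rw [Nat.choose_self]; exact hm)

theorem sub_choose_gk_le (hr : 0 < r) (m : ℕ) :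
    m - (gk (r + 1) m).choose r ≤ gk (r + 1) m ^ (r - 1) := by
  obtain ⟨q, rfl⟩ : ∃ q, r = q + 1 := ⟨r - 1, by omega⟩
  have h := lt_choose_gk_succ hr m
  rw [Nat.choose_succ_succ] at h
  have h' := Nat.choose_le_pow (gk (q + 1 + 1) m) q
  simp only [Nat.add_sub_cancel]
  simp only [Nat.succ_eq_add_one] at h
  omega

theorem cpk_zero (p k : ℕ) : cpk p k 0 = 0 := by rw [cpk]

theorem cpk_of_pos (hm : 0 < m) :
    cpk (s + 1) (r + 1) m = (gk (r + 1) m).choose s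
      + cpk (s + 1) (r + 1) (m - (gk (r + 1) m).choose r) := by
  obtain ⟨m, rfl⟩ : ∃ q, m = q + 1 := ⟨m - 1, by omega⟩
  rw [cpk]
  simp

theorem sub_choose_gk_lt (hm : 0 < m) : m - (gk (r + 1) m).choose r < m := by
  have := Nat.choose_pos (le_gk_of_pos (r := r) hm)
  omega

theorem cpk_le_mul (hr : 0 < r) (hs : s ≤ r) (m : ℕ) :
    cpk (s + 1) (r + 1) m ≤ r.choose s * m := by
  induction m using Nat.strong_induction_on with
  | _ m ih =>
    rcases Nat.eq_zero_or_pos m with rfl | hm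
    · simp [cpk_zero]
    · rw [cpk_of_pos hm]
      calc _ ≤ r.choose s * (gk (r + 1) m).choose r
            + r.choose s * (m - (gk (r + 1) m).choose r) :=
            add_le_add (Nat.choose_le_choose_mul_choose hs (le_gk_of_pos hm))
              (ih _ (sub_choose_gk_lt hm))
        _ = r.choose s * m := by
            rw [← mul_add, Nat.add_sub_cancel' (choose_gk_le hr m)]

theorem gk_pow_le (hr : 0 < r) (hm : 0 < m) :
    gk (r + 1) m ^ r ≤ r ^ r * r.factorial * m :=
  (Nat.pow_le_mul_choose hr (le_gk_of_pos hm)).trans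
    (Nat.mul_le_mul_left _ (choose_gk_le hr m))

theorem exists_cpk_le_mul_gk_pow (hs : 0 < s) (hsr : s < r) :
    ∃ A : ℕ, ∀ m, 0 < m → cpk (s + 1) (r + 1) m ≤ A * gk (r + 1) m ^ s := by
  have hr : 0 < r := hs.trans hsr
  set N := 2 ^ r * (r ^ r * r.factorial) with hN
  refine ⟨2 + r.choose s * N.choose r, fun m => ?_⟩
  set A := 2 + r.choose s * N.choose r with hA
  induction m using Nat.strong_induction_on with
  | _ m ih =>
    intro hm
    set n := gk (r + 1) m with hn
    have hn1 : 1 ≤ n ^ s := Nat.one_le_pow _ _ (hr.trans_le (le_gk_of_pos hm))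
    rcases lt_or_ge n N with hnN | hnN
    · have h1 : m ≤ N.choose r :=
        (lt_choose_gk_succ hr m).le.trans (Nat.choose_le_choose r hnN)
      calc _ ≤ r.choose s * m := cpk_le_mul hr hsr.le m
        _ ≤ r.choose s * N.choose r := Nat.mul_le_mul_left _ h1
        _ ≤ A * 1 := by omega
        _ ≤ A * n ^ s := Nat.mul_le_mul_left _ hn1
    · rw [cpk_of_pos hm, ← hn]
      have hc : n.choose s ≤ n ^ s := Nat.choose_le_pow n s
      rcases Nat.eq_zero_or_pos (m - n.choose r) with h0 | h0
      · rw [h0, cpk_zero, add_zero]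
        exact hc.trans (Nat.le_mul_of_pos_left _ (by omega))
      · have h2 := ih _ (sub_choose_gk_lt hm) h0
        have h3 := gk_pow_le hr h0
        set n' := gk (r + 1) (m - n.choose r)
        have h4 : 2 * n' ≤ n := by
          refine le_of_pow_le_pow_left₀ hr.ne' (Nat.zero_le _) ?_
          calc (2 * n') ^ r = 2 ^ r * n' ^ r := mul_pow ..
            _ ≤ 2 ^ r * (r ^ r * r.factorial * n ^ (r - 1)) := by
              gcongr
              exact h3.trans (Nat.mul_le_mul_left _ (sub_choose_gk_le hr m))
            _ = N * n ^ (r - 1) := by rw [hN]; ring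
            _ ≤ n * n ^ (r - 1) := Nat.mul_le_mul_right _ hnN
            _ = n ^ r := mul_pow_sub_one hr.ne' n
        have h5 : 2 * n' ^ s ≤ n ^ s := by
          calc 2 * n' ^ s ≤ 2 ^ s * n' ^ s :=
                Nat.mul_le_mul_right _ (Nat.le_self_pow hs.ne' 2)
            _ = (2 * n') ^ s := (mul_pow ..).symm
            _ ≤ n ^ s := Nat.pow_le_pow_left h4 s
        have hA2 : 2 ≤ A := by omega
        have h2' : cpk (s + 1) (r + 1) (m - n.choose r) ≤ A * n' ^ s := h2
        nlinarith [Nat.mul_le_mul_left A h5, Nat.mul_le_mul_right (n ^ s) hA2]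

theorem exists_cpk_le_rpow (hs : 0 < s) (hsr : s < r) :
    ∃ B : ℝ, 0 ≤ B ∧ ∀ m : ℕ, (cpk (s + 1) (r + 1) m : ℝ) ≤ B * (m : ℝ) ^ ((s : ℝ) / r) := by
  have hr : 0 < r := hs.trans hsr
  obtain ⟨A, hA⟩ := exists_cpk_le_mul_gk_pow hs hsr
  set D : ℝ := (r : ℝ) ^ r * r.factorial with hD
  refine ⟨A * D ^ ((s : ℝ) / r), by positivity, fun m => ?_⟩
  rcases Nat.eq_zero_or_pos m with rfl | hm
  · simp only [cpk_zero, Nat.cast_zero]; positivity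
  · have h1 : (cpk (s + 1) (r + 1) m : ℝ) ≤ A * (gk (r + 1) m : ℝ) ^ s := by
      exact_mod_cast hA m hm
    have h2 : (gk (r + 1) m : ℝ) ^ r ≤ D * m := by
      rw [hD]; exact_mod_cast gk_pow_le hr hm
    rw [mul_assoc, ← Real.mul_rpow (by positivity) (by positivity)]
    refine h1.trans ?_
    gcongr
    calc (gk (r + 1) m : ℝ) ^ s = ((gk (r + 1) m : ℝ) ^ r) ^ ((s : ℝ) / r) := by
          rw [← Real.rpow_natCast _ r, ← Real.rpow_mul (by positivity),
            mul_div_cancel₀ _ (by positivity), Real.rpow_natCast]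
      _ ≤ _ := by gcongr

open Filter Topology

theorem tendsto_gk_atTop (r : ℕ) : Tendsto (gk (r + 1)) atTop atTop := by
  refine tendsto_atTop.2 fun N => ?_
  filter_upwards [eventually_ge_atTop (N + N.choose r)] with m hm
  exact le_gk (by omega) (by omega)

theorem tendsto_choose_div_pow (r : ℕ) :
    Tendsto (fun n : ℕ => (n.choose r : ℝ) / (n : ℝ) ^ r) atTop (𝓝 (1 / r.factorial)) := by
  have hne : ∀ᶠ n : ℕ in atTop, (n : ℝ) ^ r / r.factorial ≠ 0 := by
    filter_upwards [eventually_gt_atTop 0] with n hn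
    positivity
  have h := ((Asymptotics.isEquivalent_iff_tendsto_one hne).1
    (isEquivalent_choose r)).div_const (r.factorial : ℝ)
  refine h.congr fun n => ?_
  simp only [Pi.div_apply]
  field_simp

theorem tendsto_choose_succ_div_pow (r : ℕ) :
    Tendsto (fun n : ℕ => ((n + 1).choose r : ℝ) / (n : ℝ) ^ r) atTop
      (𝓝 (1 / r.factorial)) := by
  have h1 := (tendsto_choose_div_pow r).comp (tendsto_add_atTop_nat 1)
  have h2 : Tendsto (fun n : ℕ => (1 + 1 / (n : ℝ)) ^ r) atTop (𝓝 1) := by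
    simpa using ((tendsto_one_div_atTop_nhds_zero_nat (𝕜 := ℝ)).const_add 1).pow r
  have h3 := h1.mul h2
  rw [mul_one] at h3
  refine h3.congr' ?_
  filter_upwards [eventually_gt_atTop 0] with n hn
  have : (0 : ℝ) < n := by exact_mod_cast hn
  simp only [Function.comp_apply, Nat.cast_add, Nat.cast_one]
  rw [show 1 + 1 / (n : ℝ) = (n + 1) / n by field_simp, div_pow]
  field_simp

theorem tendsto_div_gk_pow (hr : 0 < r) :
    Tendsto (fun m : ℕ => (m : ℝ) / (gk (r + 1) m : ℝ) ^ r) atTop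
      (𝓝 (1 / r.factorial)) := by
  refine tendsto_of_tendsto_of_tendsto_of_le_of_le
    ((tendsto_choose_div_pow r).comp (tendsto_gk_atTop r))
    ((tendsto_choose_succ_div_pow r).comp (tendsto_gk_atTop r)) (fun m => ?_) (fun m => ?_)
  · have := choose_gk_le hr m
    simp only [Function.comp_apply]
    gcongr
  · have := (lt_choose_gk_succ hr m).le
    simp only [Function.comp_apply]
    gcongr

theorem tendsto_cpk_sub_div_gk_pow (hs : 0 < s) (hsr : s < r) :
    Tendsto (fun m : ℕ => (cpk (s + 1) (r + 1) (m - (gk (r + 1) m).choose r) : ℝ)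
      / (gk (r + 1) m : ℝ) ^ s) atTop (𝓝 0) := by
  have hr : 0 < r := hs.trans hsr
  have hr' : (0 : ℝ) < r := by exact_mod_cast hr
  have hs' : (0 : ℝ) < s := by exact_mod_cast hs
  obtain ⟨B, hB, h⟩ := exists_cpk_le_rpow hs hsr
  have hlim : Tendsto (fun m : ℕ => B * (gk (r + 1) m : ℝ) ^ (-((s : ℝ) / r))) atTop (𝓝 0) := by
    simpa using ((tendsto_rpow_neg_atTop (div_pos hs' hr')).comp
      (tendsto_natCast_atTop_atTop.comp (tendsto_gk_atTop r))).const_mul B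
  refine tendsto_of_tendsto_of_tendsto_of_le_of_le' tendsto_const_nhds hlim
    (Eventually.of_forall fun m => by positivity) ?_
  filter_upwards [eventually_gt_atTop 0] with m hm
  have hn : (0 : ℝ) < gk (r + 1) m := by exact_mod_cast hr.trans_le (le_gk_of_pos hm)
  have h1 : ((m - (gk (r + 1) m).choose r : ℕ) : ℝ) ≤ (gk (r + 1) m : ℝ) ^ ((r : ℝ) - 1) := by
    rw [← Nat.cast_pred hr, Real.rpow_natCast]
    exact_mod_cast sub_choose_gk_le hr m
  rw [div_le_iff₀ (by positivity)]
  refine (h _).trans ?_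
  rw [mul_assoc, ← Real.rpow_natCast _ s, ← Real.rpow_add hn]
  gcongr
  calc _ ≤ ((gk (r + 1) m : ℝ) ^ ((r : ℝ) - 1)) ^ ((s : ℝ) / r) := by gcongr
    _ = _ := by
      rw [← Real.rpow_mul hn.le]
      congr 1
      field_simp
      ring

theorem tendsto_cpk_div_gk_pow (hs : 0 < s) (hsr : s < r) :
    Tendsto (fun m : ℕ => (cpk (s + 1) (r + 1) m : ℝ) / (gk (r + 1) m : ℝ) ^ s) atTop
      (𝓝 (1 / s.factorial)) := by
  have h := ((tendsto_choose_div_pow s).comp (tendsto_gk_atTop r)).add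
    (tendsto_cpk_sub_div_gk_pow hs hsr)
  rw [add_zero] at h
  refine h.congr' ?_
  filter_upwards [eventually_gt_atTop 0] with m hm
  rw [cpk_of_pos hm]
  simp [add_div]

end

open Filter in
/-- Let `k > p > 1` be integers.  Then
`c_p^k(m) / m^((p-1)/(k-1)) → ((k-1)!)^((p-1)/(k-1)) / (p-1)!` as `m → ∞`. -/
theorem stmt_6 (k p : ℕ) (hp : 1 < p) (hpk : p < k) :
    Tendsto (fun m : ℕ => (cpk p k m : ℝ) / (m : ℝ) ^ (((p : ℝ) - 1) / ((k : ℝ) - 1)))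
      atTop
      (nhds ((Nat.factorial (k - 1) : ℝ) ^ (((p : ℝ) - 1) / ((k : ℝ) - 1)) /
        (Nat.factorial (p - 1) : ℝ))) := by
  obtain ⟨s, rfl⟩ : ∃ s, p = s + 1 := ⟨p - 1, by omega⟩
  obtain ⟨r, rfl⟩ : ∃ r, k = r + 1 := ⟨k - 1, by omega⟩
  have hs : 0 < s := by omega
  have hsr : s < r := by omega
  have hr : 0 < r := hs.trans hsr
  have hr' : (r : ℝ) ≠ 0 := by positivity
  simp only [Nat.cast_add, Nat.cast_one, add_sub_cancel_right]
  have h := (tendsto_cpk_div_gk_pow hs hsr).div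
    ((tendsto_div_gk_pow hr).rpow_const (p := (s : ℝ) / r) (Or.inr (by positivity)))
    (by positivity)
  have hlim : (1 / (s.factorial : ℝ)) / (1 / (r.factorial : ℝ)) ^ ((s : ℝ) / r)
      = (r.factorial : ℝ) ^ ((s : ℝ) / r) / s.factorial := by
    rw [Real.div_rpow (by positivity) (by positivity), Real.one_rpow]
    field_simp
  rw [hlim] at h
  refine h.congr' ?_
  filter_upwards [eventually_gt_atTop 0] with m hm
  have hn : (0 : ℝ) < gk (r + 1) m := by exact_mod_cast hr.trans_le (le_gk_of_pos hm)
  have hm' : (0 : ℝ) < m := by exact_mod_cast hm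
  have hpow : ((gk (r + 1) m : ℝ) ^ r) ^ ((s : ℝ) / r) = (gk (r + 1) m : ℝ) ^ s := by
    rw [← Real.rpow_natCast _ r, ← Real.rpow_mul hn.le, mul_div_cancel₀ _ hr',
      Real.rpow_natCast]
  simp only [Pi.div_apply]
  rw [Real.div_rpow hm'.le (by positivity), hpow]
  field_simp
end

section
/- Let k, p, v, and w be positive integers with k > p. Write v = C(a, k) + C(b, k-1) + m with a > b and C(b, k-2) > m ≥ 0 (the unique such representation). If w ≥ C(a, p) + C(b, p-1) + c_p^k(m), then there exists a finite simple graph G whose number of cliques on k vertices is exactly v and whose number of cliques on p vertices is exactly w (equivalently, a flag complex Δ with f_{k-1}(Δ) = v and f_{p-1}(Δ) = w). -/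
/-- `HasCliqueCounts a f`: some finite graph contains a clique on `a` vertices and has exactly
`f r` cliques on `r + 1` vertices for every `r`. -/
def HasCliqueCounts (a : ℕ) (f : ℕ → ℕ) : Prop :=
  ∃ (V : Type) (_ : Fintype V) (G : SimpleGraph V) (S : Finset V),
    G.IsNClique a S ∧ ∀ r, (G.cliqueSet (r + 1)).ncard = f r

/-- The graph obtained from `G` by adding a vertex `none` whose neighbours are the elements
of `T`. -/
def SimpleGraph.addVertex {V : Type*} (G : SimpleGraph V) (T : Finset V) :
    SimpleGraph (Option V) where
  Adj
    | none, none => False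
    | none, some v => v ∈ T
    | some u, none => u ∈ T
    | some u, some v => G.Adj u v
  symm := ⟨by
    rintro (_ | u) (_ | v) h
    · exact h
    · exact h
    · exact h
    · exact G.adj_symm h⟩
  loopless := ⟨by
    rintro (_ | u) h
    · exact h
    · exact G.loopless.irrefl u h⟩

namespace SimpleGraph

variable {V : Type*} (G : SimpleGraph V) (T : Finset V)

lemma isClique_addVertex_map_some (s : Finset V) :
    (G.addVertex T).IsClique (s.map Function.Embedding.some : Finset (Option V)) ↔
      G.IsClique s := by
  constructor
  · intro h u hu v hv huv
    exact @h (some u) (by simpa using hu) (some v) (by simpa using hv) (by simpa using huv)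
  · intro h x hx y hy hxy
    simp only [Finset.coe_map, Set.mem_image, Finset.mem_coe] at hx hy
    obtain ⟨u, hu, rfl⟩ := hx
    obtain ⟨v, hv, rfl⟩ := hy
    exact h hu hv (by rintro rfl; exact hxy rfl)

lemma isClique_addVertex_insertNone (s : Finset V) :
    (G.addVertex T).IsClique (Finset.insertNone s : Finset (Option V)) ↔
      G.IsClique s ∧ s ⊆ T := by
  constructor
  · intro h
    refine ⟨fun u hu v hv huv => ?_, fun u hu => ?_⟩
    · exact @h (some u) (by simpa using hu) (some v) (by simpa using hv) (by simpa using huv)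
    · exact @h (some u) (by simpa using hu) none (by simp) (by simp)
  · rintro ⟨h, hT⟩ (_ | u) hx (_ | v) hy hxy
    · exact hxy rfl
    · exact hT (by simpa using hy)
    · exact hT (by simpa using hx)
    · exact h (by simpa using hx) (by simpa using hy) (by rintro rfl; exact hxy rfl)

variable {G T}

lemma cliqueSet_addVertex (hT : G.IsClique T) (r : ℕ) :
    (G.addVertex T).cliqueSet (r + 1) =
      (fun s => s.map Function.Embedding.some) '' G.cliqueSet (r + 1) ∪
        Finset.insertNone '' (T.powersetCard r : Set (Finset V)) := by
  classical
  ext s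
  simp only [mem_cliqueSet_iff, isNClique_iff, Set.mem_union, Set.mem_image, Finset.mem_coe,
    Finset.mem_powersetCard]
  constructor
  · rintro ⟨hs, hc⟩
    by_cases hn : none ∈ s
    · have he : Finset.insertNone s.eraseNone = s := by
        rw [Finset.insertNone_eraseNone, Finset.insert_eq_of_mem hn]
      rw [← he] at hs hc
      rw [isClique_addVertex_insertNone] at hs
      rw [Finset.card_insertNone] at hc
      exact Or.inr ⟨_, ⟨hs.2, by omega⟩, he⟩
    · have he : s.eraseNone.map Function.Embedding.some = s := by
        rw [Finset.map_some_eraseNone, Finset.erase_eq_of_notMem hn]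
      rw [← he] at hs hc
      rw [isClique_addVertex_map_some] at hs
      rw [Finset.card_map] at hc
      exact Or.inl ⟨_, ⟨hs, hc⟩, he⟩
  · rintro (⟨t, ⟨ht, hc⟩, rfl⟩ | ⟨t, ⟨ht, hc⟩, rfl⟩)
    · exact ⟨(isClique_addVertex_map_some G T t).2 ht, by rw [Finset.card_map, hc]⟩
    · exact ⟨(isClique_addVertex_insertNone G T t).2 ⟨hT.subset (by exact_mod_cast ht), ht⟩,
        by rw [Finset.card_insertNone, hc]⟩

lemma ncard_cliqueSet_addVertex [Finite V] (hT : G.IsClique T) (r : ℕ) :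
    ((G.addVertex T).cliqueSet (r + 1)).ncard =
      (G.cliqueSet (r + 1)).ncard + T.card.choose r := by
  rw [cliqueSet_addVertex hT, Set.ncard_union_eq ?_ (Set.toFinite _) (Set.toFinite _),
    Set.ncard_image_of_injective _ (Finset.map_injective _),
    Set.ncard_image_of_injective _ Finset.insertNone.injective, Set.ncard_coe_finset,
    Finset.card_powersetCard]
  rw [Set.disjoint_left]
  rintro _ ⟨s, -, rfl⟩ ⟨t, -, h⟩
  have : none ∈ s.map Function.Embedding.some := by
    rw [show s.map Function.Embedding.some = Finset.insertNone t from h.symm]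
    simp
  simp at this

end SimpleGraph

namespace HasCliqueCounts

variable {a : ℕ} {f : ℕ → ℕ}

lemma complete (a : ℕ) : HasCliqueCounts a (fun r => a.choose (r + 1)) := by
  refine ⟨Fin a, inferInstance, ⊤, Finset.univ, ?_, fun r => ?_⟩
  · simp [SimpleGraph.isNClique_iff]
  · have : (⊤ : SimpleGraph (Fin a)).cliqueSet (r + 1) =
        (Finset.univ.powersetCard (r + 1) : Finset (Finset (Fin a))) := by
      ext s
      simp [SimpleGraph.isNClique_iff]
    rw [this, Set.ncard_coe_finset, Finset.card_powersetCard, Finset.card_univ, Fintype.card_fin]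

lemma add_choose (h : HasCliqueCounts a f) {g : ℕ} (hg : g ≤ a) :
    HasCliqueCounts a (fun r => f r + g.choose r) := by
  obtain ⟨V, _, G, S, hS, hf⟩ := h
  obtain ⟨T, hTS, rfl⟩ := Finset.exists_subset_card_eq (hS.card_eq.symm ▸ hg)
  have hT : G.IsClique T := hS.isClique.subset (by exact_mod_cast hTS)
  refine ⟨Option V, inferInstance, G.addVertex T, S.map Function.Embedding.some, ?_, fun r => ?_⟩
  · rw [SimpleGraph.isNClique_iff, SimpleGraph.isClique_addVertex_map_some, Finset.card_map]
    exact ⟨hS.isClique, hS.card_eq⟩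
  · rw [SimpleGraph.ncard_cliqueSet_addVertex hT, hf]

lemma add_mul_choose (h : HasCliqueCounts a f) {g : ℕ} (hg : g ≤ a) (t : ℕ) :
    HasCliqueCounts a (fun r => f r + t * g.choose r) := by
  induction t with
  | zero => simpa using h
  | succ t ih => simpa only [Nat.succ_mul, add_assoc] using ih.add_choose hg

lemma exists_add_cpk {p k : ℕ} (hk : 0 < k - 1) (m : ℕ) (hm : m < (a + 1).choose (k - 1))
    (h : HasCliqueCounts a f) :
    ∃ f', HasCliqueCounts a f' ∧ f' (k - 1) = f (k - 1) + m ∧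
      f' (p - 1) = f (p - 1) + cpk p k m := by
  induction m using Nat.strong_induction_on generalizing f with
  | _ m ih =>
    rcases m with _ | m
    · exact ⟨f, h, rfl, by rw [cpk]; rfl⟩
    · have hle : (gk k (m + 1)).choose (k - 1) ≤ m + 1 :=
        Nat.findGreatest_spec (P := fun n => n.choose (k - 1) ≤ m + 1) (m := k - 1)
          (by omega) (by simp)
      have hge : k - 1 ≤ gk k (m + 1) := Nat.le_findGreatest (by omega) (by simp)
      have hpos := Nat.choose_pos hge
      have hga : gk k (m + 1) ≤ a := by
        by_contra! hlt
        have := Nat.choose_le_choose (k - 1) (show a + 1 ≤ gk k (m + 1) from hlt)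
        omega
      obtain ⟨f', hf', hfk, hfp⟩ := ih (m + 1 - (gk k (m + 1)).choose (k - 1)) (by omega)
        (by omega) (h.add_choose hga)
      refine ⟨f', hf', by omega, ?_⟩
      rw [hfp, cpk, add_assoc]

lemma exists_fin (h : HasCliqueCounts a f) :
    ∃ (n : ℕ) (G : SimpleGraph (Fin n)), ∀ r, (G.cliqueSet (r + 1)).ncard = f r := by
  obtain ⟨V, _, G, -, -, hf⟩ := h
  refine ⟨Fintype.card V, G.map (Fintype.equivFin V), fun r => ?_⟩
  rw [SimpleGraph.cliqueSet_map_of_equiv,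
    Set.ncard_image_of_injective _ (Finset.map_injective _), hf]

end HasCliqueCounts

/-- Let `k, p, v, w` be positive integers with `k > p`.  Write
`v = C(a, k) + C(b, k-1) + m` with `a > b` and `C(b, k-2) > m ≥ 0` (the unique such
representation).  If `w ≥ C(a, p) + C(b, p-1) + c_p^k(m)`, then there exists a finite simple
graph whose number of cliques on `k` vertices is exactly `v` and whose number of cliques on
`p` vertices is exactly `w`. -/
theorem stmt_7 (k p v w a b m : ℕ) (hp : 0 < p) (hpk : p < k) (hv : 0 < v) (hw : 0 < w)
    (hrep : v = Nat.choose a k + Nat.choose b (k - 1) + m)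
    (hab : b < a) (hm : m < Nat.choose b (k - 2))
    (hwge : Nat.choose a p + Nat.choose b (p - 1) + cpk p k m ≤ w) :
    ∃ (n : ℕ) (G : SimpleGraph (Fin n)),
      (G.cliqueSet k).ncard = v ∧ (G.cliqueSet p).ncard = w := by
  have hak : k ≤ a := by
    have hb : k - 2 ≤ b := by
      by_contra! hlt
      rw [Nat.choose_eq_zero_of_lt hlt] at hm
      omega
    by_contra! hlt
    obtain rfl : b = k - 2 := by omega
    rw [Nat.choose_self] at hm
    rw [Nat.choose_eq_zero_of_lt hlt, Nat.choose_eq_zero_of_lt (by omega)] at hrep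
    omega
  have hma : m < (a + 1).choose (k - 1) := by
    have hpascal : (b + 1).choose (k - 1) = b.choose (k - 2) + b.choose (k - 1) := by
      obtain ⟨j, rfl⟩ : ∃ j, k = j + 2 := ⟨k - 2, by omega⟩
      exact Nat.choose_succ_succ b j
    have := Nat.choose_le_choose (k - 1) (show b + 1 ≤ a + 1 by omega)
    omega
  obtain ⟨f, hf, hfk, hfp⟩ := HasCliqueCounts.exists_add_cpk (p := p) (k := k) (by omega) m hma
    ((HasCliqueCounts.complete a).add_choose hab.le)
  rw [Nat.sub_add_cancel (by omega)] at hfk hfp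
  obtain ⟨n, G, hG⟩ := (hf.add_mul_choose (show p - 1 ≤ a by omega) (w - f (p - 1))).exists_fin
  have hGk := hG (k - 1)
  have hGp := hG (p - 1)
  rw [Nat.sub_add_cancel (by omega), Nat.choose_eq_zero_of_lt (by omega)] at hGk
  rw [Nat.sub_add_cancel hp, Nat.choose_self] at hGp
  exact ⟨n, G, by omega, by omega⟩
end

section
/- Given positive integers m, k, and r with r ≥ k, there are unique integers s ≥ 0 and n_k, n_{k-1}, ..., n_{k-s} such that m = C(n_k, k)_r + C(n_{k-1}, k-1)_{r-1} + ... + C(n_{k-s}, k-s)_{r-s}, with n_{k-i} − floor(n_{k-i}/(r-i)) > n_{k-i-1} for all 0 ≤ i < s, and n_{k-s} ≥ k-s > 0. -/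
/-- `tc n k r` : the number of cliques on `k` vertices in the Turán graph `T_{n,r}`
(the complete multipartite graph on `n` vertices whose `r` parts are as equal as possible).
This is the quantity `C(n,k)_r`. -/
noncomputable def tc (n k r : ℕ) : ℕ := ((SimpleGraph.turanGraph n r).cliqueSet k).ncard

open Classical in
/-- The `k`-element subsets of `A` whose elements have pairwise distinct colours under `c`. -/
noncomputable def rainbowSets {α β : Type*} (c : α → β) (A : Finset α) (k : ℕ) :
    Finset (Finset α) :=
  {s ∈ A.powersetCard k | Set.InjOn c (s : Set α)}

lemma mem_rainbowSets {α β : Type*} {c : α → β} {A : Finset α} {k : ℕ} {s : Finset α} :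
    s ∈ rainbowSets c A k ↔ (s ⊆ A ∧ s.card = k) ∧ Set.InjOn c (s : Set α) := by
  simp [rainbowSets]

lemma card_rainbowSets_map {α α' β β' : Type*} (e : α ↪ α') (c : α → β) (c' : α' → β')
    (h : ∀ x y, c' (e x) = c' (e y) ↔ c x = c y) (A : Finset α) (k : ℕ) :
    (rainbowSets c' (A.map e) k).card = (rainbowSets c A k).card := by
  classical
  simp only [rainbowSets]
  rw [Finset.powersetCard_map, Finset.filter_map, Finset.card_map]
  congr 1
  refine Finset.filter_congr fun s _ => ?_
  simp [Set.InjOn, h]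

lemma card_rainbowSets_insert {α β : Type*} [DecidableEq α] [DecidableEq β] (c : α → β)
    {A : Finset α} {a : α} (ha : a ∉ A) (k : ℕ) :
    (rainbowSets c (insert a A) (k + 1)).card =
      (rainbowSets c A (k + 1)).card + (rainbowSets c {x ∈ A | c x ≠ c a} k).card := by
  have hsplit : rainbowSets c (insert a A) (k + 1) = rainbowSets c A (k + 1) ∪
      (rainbowSets c {x ∈ A | c x ≠ c a} k).image (insert a) := by
    ext s
    simp only [Finset.mem_union, Finset.mem_image, mem_rainbowSets]
    constructor
    · rintro ⟨⟨hs, hcard⟩, hinj⟩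
      by_cases has : a ∈ s
      · refine Or.inr ⟨s.erase a, ⟨⟨fun x hx => ?_, ?_⟩, ?_⟩, Finset.insert_erase has⟩
        · have hx' := Finset.mem_erase.1 hx
          refine Finset.mem_filter.2 ⟨Finset.mem_of_mem_insert_of_ne (hs hx'.2) hx'.1, fun h => ?_⟩
          exact hx'.1 (hinj hx'.2 has h)
        · rw [Finset.card_erase_of_mem has, hcard, Nat.add_sub_cancel]
        · exact hinj.mono (by simp)
      · exact Or.inl ⟨⟨(Finset.subset_insert_iff_of_notMem has).1 hs, hcard⟩, hinj⟩
    · rintro (⟨⟨hs, hcard⟩, hinj⟩ | ⟨t, ⟨⟨ht, hcard⟩, hinj⟩, rfl⟩)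
      · exact ⟨⟨hs.trans (Finset.subset_insert _ _), hcard⟩, hinj⟩
      · have hat : a ∉ t := fun h => ha (Finset.mem_filter.1 (ht h)).1
        refine ⟨⟨Finset.insert_subset_insert _ (ht.trans (Finset.filter_subset _ _)), ?_⟩, ?_⟩
        · rw [Finset.card_insert_of_notMem hat, hcard]
        · rw [Finset.coe_insert, Set.injOn_insert (by simpa using hat)]
          refine ⟨hinj, ?_⟩
          rintro ⟨x, hx, hxa⟩
          exact (Finset.mem_filter.1 (ht hx)).2 hxa
  rw [hsplit, Finset.card_union_of_disjoint, Finset.card_image_of_injOn]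
  · intro s hs t ht hst
    have key : ∀ u ∈ rainbowSets c {x ∈ A | c x ≠ c a} k, a ∉ u := fun u hu h =>
      ha (Finset.mem_filter.1 ((mem_rainbowSets.1 hu).1.1 h)).1
    rw [← Finset.erase_insert (key s hs), ← Finset.erase_insert (key t ht)]
    exact congrArg (Finset.erase · a) hst
  · rw [Finset.disjoint_left]
    intro s hs hs'
    obtain ⟨t, -, rfl⟩ := Finset.mem_image.1 hs'
    exact ha ((mem_rainbowSets.1 hs).1.1 (Finset.mem_insert_self _ _))

lemma tc_eq_card_rainbowSets (n k r : ℕ) :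
    tc n k r = (rainbowSets (· % r) (Finset.range n) k).card := by
  have hrange : Finset.range n = Finset.univ.map (Fin.valEmbedding (n := n)) := by
    ext x
    simp only [Finset.mem_range, Finset.mem_map, Finset.mem_univ, true_and]
    exact ⟨fun h => ⟨⟨x, h⟩, rfl⟩, by rintro ⟨y, rfl⟩; exact y.2⟩
  rw [hrange, card_rainbowSets_map _ (fun v : Fin n => (v : ℕ) % r) _ (fun _ _ => Iff.rfl), tc,
    ← Set.ncard_coe_finset]
  congr 1
  ext s
  rw [SimpleGraph.mem_cliqueSet_iff, SimpleGraph.isNClique_iff, SimpleGraph.isClique_iff,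
    Finset.mem_coe, mem_rainbowSets, Set.injOn_iff_pairwise_ne, and_comm]
  simp only [Finset.subset_univ, true_and]
  rfl

/-- The order embedding of `ℕ` whose range is the set of naturals not congruent to `a`
modulo `r + 1` (for `a ≤ r`). -/
def skipResidue (r a w : ℕ) : ℕ := (r + 1) * (w / r) + if w % r < a then w % r else w % r + 1

lemma skipResidue_mod {r a w : ℕ} (hr : 0 < r) :
    skipResidue r a w % (r + 1) = if w % r < a then w % r else w % r + 1 := by
  have := Nat.mod_lt w hr
  rw [skipResidue, Nat.mul_add_mod, Nat.mod_eq_of_lt]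
  split_ifs <;> omega

lemma skipResidue_div {r a w : ℕ} (hr : 0 < r) : skipResidue r a w / (r + 1) = w / r := by
  have := Nat.mod_lt w hr
  rw [skipResidue, Nat.mul_add_div (by omega), Nat.add_eq_left, Nat.div_eq_of_lt]
  split_ifs <;> omega

lemma skipResidue_mod_eq_iff {r a v w : ℕ} (hr : 0 < r) :
    skipResidue r a v % (r + 1) = skipResidue r a w % (r + 1) ↔ v % r = w % r := by
  rw [skipResidue_mod hr, skipResidue_mod hr]
  split_ifs <;> omega

lemma skipResidue_injective {r : ℕ} (hr : 0 < r) (a : ℕ) :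
    Function.Injective (skipResidue r a) := by
  intro v w h
  have hmod := (skipResidue_mod_eq_iff (a := a) hr).1 (congrArg (· % (r + 1)) h)
  have hdiv := congrArg (· / (r + 1)) h
  simp only [skipResidue_div hr] at hdiv
  rw [← Nat.div_add_mod v r, ← Nat.div_add_mod w r, hmod, hdiv]

lemma map_skipResidue_range {r : ℕ} (hr : 0 < r) (n : ℕ) :
    (Finset.range (n - n / (r + 1))).map ⟨_, skipResidue_injective hr (n % (r + 1))⟩ =
      {v ∈ Finset.range n | v % (r + 1) ≠ n % (r + 1)} := by
  have hn := Nat.div_add_mod n (r + 1)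
  have hnr := Nat.mod_lt n (Nat.succ_pos r)
  set q := n / (r + 1)
  set a := n % (r + 1)
  have hsub : n - q = r * q + a := by
    rw [add_mul] at hn
    omega
  ext v
  simp only [Finset.mem_map, Finset.mem_range, Function.Embedding.coeFn_mk, Finset.mem_filter, hsub]
  constructor
  · rintro ⟨w, hw, rfl⟩
    have hwr := Nat.mod_lt w hr
    have hw' := Nat.div_add_mod w r
    refine ⟨?_, ?_⟩
    · rcases lt_or_ge (w / r) q with h | h
      · have : (r + 1) * (w / r + 1) ≤ (r + 1) * q := Nat.mul_le_mul_left _ h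
        rw [skipResidue]
        split_ifs <;> nlinarith
      · have h' : w / r = q := by
          refine le_antisymm ?_ h
          by_contra! hlt
          have : r * (q + 1) ≤ r * (w / r) := Nat.mul_le_mul_left _ hlt
          rw [mul_add_one] at this
          omega
        rw [h'] at hw'
        have : w % r < a := by omega
        rw [skipResidue, if_pos this, h']
        omega
    · rw [skipResidue_mod hr]
      split_ifs <;> omega
  · rintro ⟨hv, hne⟩
    have hvr := Nat.mod_lt v (Nat.succ_pos r)
    have hv' := Nat.div_add_mod v (r + 1)
    have hvq : v / (r + 1) ≤ q := Nat.div_le_div_right hv.le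
    set p := v / (r + 1)
    set b := v % (r + 1)
    have hpq : r * p ≤ r * q := Nat.mul_le_mul_left _ hvq
    have hb : ∃ b' < r, (if b' < a then b' else b' + 1) = b ∧ (p < q ∨ b' < a) := by
      rcases lt_or_gt_of_ne hne with h | h
      · exact ⟨b, by omega, by rw [if_pos h], Or.inr h⟩
      · refine ⟨b - 1, by omega, by rw [if_neg (by omega)]; omega, ?_⟩
        refine Or.inl (lt_of_le_of_ne hvq fun hpq => ?_)
        rw [hpq] at hv'
        omega
    obtain ⟨b', hb'r, hb'b, hlt⟩ := hb
    refine ⟨r * p + b', ?_, ?_⟩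
    · rcases hlt with h | h
      · have : r * (p + 1) ≤ r * q := Nat.mul_le_mul_left _ h
        nlinarith
      · omega
    · rw [skipResidue, Nat.mul_add_div hr, Nat.div_eq_of_lt hb'r, Nat.mul_add_mod,
        Nat.mod_eq_of_lt hb'r, hb'b, add_zero, hv']

lemma tc_succ (n k r : ℕ) :
    tc (n + 1) (k + 1) (r + 1) = tc n (k + 1) (r + 1) + tc (n - n / (r + 1)) k r := by
  simp only [tc_eq_card_rainbowSets]
  rw [Finset.range_add_one, card_rainbowSets_insert _ Finset.notMem_range_self]
  congr 1
  rcases Nat.eq_zero_or_pos r with rfl | hr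
  · cases k <;> simp [rainbowSets, Nat.mod_one, Finset.filter_singleton]
  · rw [← map_skipResidue_range hr]
    exact card_rainbowSets_map _ _ _ (fun _ _ => skipResidue_mod_eq_iff hr) _ _

lemma tc_zero_right (n r : ℕ) : tc n 0 r = 1 := by
  rw [tc_eq_card_rainbowSets]
  simp [rainbowSets, Finset.filter_singleton]

lemma tc_eq_zero {n k : ℕ} (h : n < k) (r : ℕ) : tc n k r = 0 := by
  rw [tc_eq_card_rainbowSets, rainbowSets, Finset.powersetCard_eq_empty.2 (by simpa using h)]
  simp

lemma le_sub_div_succ {n k r : ℕ} (hkn : k ≤ n) (hkr : k ≤ r) : k ≤ n - n / (r + 1) := by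
  have hn := Nat.div_add_mod n (r + 1)
  rw [add_mul, one_mul] at hn
  rcases Nat.eq_zero_or_pos (n / (r + 1)) with h | h
  · omega
  · have : r ≤ r * (n / (r + 1)) := Nat.le_mul_of_pos_right r h
    omega

lemma tc_pos {n k r : ℕ} (hkn : k ≤ n) (hkr : k ≤ r) : 0 < tc n k r := by
  induction k generalizing n r with
  | zero => simp [tc_zero_right]
  | succ k ih =>
    obtain ⟨n, rfl⟩ := Nat.exists_eq_add_one_of_ne_zero (n := n) (by omega)
    obtain ⟨r, rfl⟩ := Nat.exists_eq_add_one_of_ne_zero (n := r) (by omega)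
    rw [tc_succ]
    exact Nat.add_pos_right _ (ih (le_sub_div_succ (by omega) (by omega)) (by omega))

lemma tc_monotone {k r : ℕ} (hkr : k ≤ r) : Monotone fun n => tc n k r := by
  refine monotone_nat_of_le_succ fun n => ?_
  cases k with
  | zero => simp [tc_zero_right]
  | succ k =>
    obtain ⟨r, rfl⟩ := Nat.exists_eq_add_one_of_ne_zero (n := r) (by omega)
    rw [tc_succ]
    exact Nat.le_add_right _ _

lemma le_tc_add {k r : ℕ} (hkr : k ≤ r) (n : ℕ) : n ≤ tc (n + k) (k + 1) (r + 1) := by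
  induction n with
  | zero => exact Nat.zero_le _
  | succ n ih =>
    have := tc_pos (le_sub_div_succ (n := n + k) (by omega) hkr) hkr
    rw [Nat.add_right_comm, tc_succ]
    omega

lemma exists_tc_le_lt {k r : ℕ} (hkr : k ≤ r) (m : ℕ) :
    ∃ n, tc n (k + 1) (r + 1) ≤ m ∧ m < tc (n + 1) (k + 1) (r + 1) := by
  have hex : ∃ n, m < tc n (k + 1) (r + 1) := ⟨_, le_tc_add hkr (m + 1)⟩
  classical
  obtain ⟨n, hn⟩ := Nat.exists_eq_add_one_of_ne_zero (n := Nat.find hex) fun h => by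
    have := Nat.find_spec hex
    rw [h, tc_eq_zero k.succ_pos] at this
    omega
  exact ⟨n, not_lt.1 (Nat.find_min hex (by omega)), hn ▸ Nat.find_spec hex⟩

/-- `n 0, …, n s` represent `m` in the Turán analogue of the `k`-cascade form. -/
structure IsTuranCascade (m k r s : ℕ) (n : ℕ → ℕ) : Prop where
  sum_eq : m = ∑ i ∈ Finset.range (s + 1), tc (n i) (k - i) (r - i)
  lt : ∀ i, i < s → n (i + 1) < n i - n i / (r - i)
  le_last : k - s ≤ n s
  length_lt : s < k

namespace IsTuranCascade

variable {m k r s : ℕ} {n : ℕ → ℕ}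

lemma pos (h : IsTuranCascade m k r s n) (hkr : k ≤ r) : 0 < m := by
  rw [h.sum_eq, Finset.sum_range_succ]
  exact Nat.add_pos_right _ (tc_pos h.le_last (by omega))

lemma tail (h : IsTuranCascade m (k + 1) (r + 1) (s + 1) n) :
    IsTuranCascade (m - tc (n 0) (k + 1) (r + 1)) k r s (fun i => n (i + 1)) where
  sum_eq := by
    rw [h.sum_eq, Finset.sum_range_succ', Nat.sub_zero, Nat.sub_zero, Nat.add_sub_cancel]
    simp only [Nat.add_sub_add_right]
  lt i hi := by simpa using h.lt (i + 1) (by omega)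
  le_last := by simpa using h.le_last
  length_lt := by simpa using h.length_lt

lemma tc_le (h : IsTuranCascade m k r s n) : tc (n 0) k r ≤ m := by
  rw [h.sum_eq, Finset.sum_range_succ']
  exact Nat.le_add_left _ _

lemma lt_tc (h : IsTuranCascade m k r s n) (hkr : k ≤ r) : m < tc (n 0 + 1) k r := by
  induction s generalizing m k r n with
  | zero =>
    obtain ⟨k, rfl⟩ := Nat.exists_eq_add_one_of_ne_zero (n := k) (by have := h.length_lt; omega)
    obtain ⟨r, rfl⟩ := Nat.exists_eq_add_one_of_ne_zero (n := r) (by omega)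
    have hlast := h.le_last
    have hle : k ≤ n 0 - n 0 / (r + 1) := le_sub_div_succ (by omega) (by omega)
    have := tc_pos (r := r) hle (by omega)
    rw [tc_succ, h.sum_eq]
    simpa using this
  | succ s ih =>
    obtain ⟨k, rfl⟩ := Nat.exists_eq_add_one_of_ne_zero (n := k) (by have := h.length_lt; omega)
    obtain ⟨r, rfl⟩ := Nat.exists_eq_add_one_of_ne_zero (n := r) (by omega)
    have htail := ih h.tail (by omega)
    have hmono := tc_monotone (k := k) (r := r) (by omega) (h.lt 0 (by omega))
    have hle := h.tc_le
    simp only [zero_add, Nat.sub_zero, Nat.succ_eq_add_one] at hmono htail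
    rw [tc_succ]
    omega

lemma unique {s' : ℕ} {n' : ℕ → ℕ} (h : IsTuranCascade m k r s n)
    (h' : IsTuranCascade m k r s' n') (hkr : k ≤ r) : s' = s ∧ ∀ i ≤ s, n' i = n i := by
  induction k generalizing m r s s' n n' with
  | zero => exact absurd h.length_lt (Nat.not_lt_zero _)
  | succ k ih =>
    obtain ⟨r, rfl⟩ := Nat.exists_eq_add_one_of_ne_zero (n := r) (by omega)
    have hmono := tc_monotone hkr
    have h0 : n' 0 = n 0 := le_antisymm
      (Nat.lt_succ_iff.1 (hmono.reflect_lt (h'.tc_le.trans_lt (h.lt_tc hkr))))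
      (Nat.lt_succ_iff.1 (hmono.reflect_lt (h.tc_le.trans_lt (h'.lt_tc hkr))))
    rcases s with _ | s <;> rcases s' with _ | s'
    · simpa using h0
    · have hpos := h'.tail.pos (by omega)
      have hsum := h.sum_eq
      simp [h0] at hpos hsum
      omega
    · have hpos := h.tail.pos (by omega)
      have hsum := h'.sum_eq
      simp [h0] at hpos hsum
      omega
    · have htail' := h'.tail
      rw [h0] at htail'
      obtain ⟨rfl, hn⟩ := ih h.tail htail' (by omega)
      refine ⟨rfl, fun i hi => ?_⟩
      cases i with
      | zero => exact h0
      | succ i => exact hn i (by omega)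

end IsTuranCascade

lemma exists_isTuranCascade {m k r : ℕ} (hm : 0 < m) (hk : 0 < k) (hkr : k ≤ r) :
    ∃ s n, IsTuranCascade m k r s n := by
  induction k generalizing m r with
  | zero => omega
  | succ k ih =>
    obtain ⟨r, rfl⟩ := Nat.exists_eq_add_one_of_ne_zero (n := r) (by omega)
    obtain ⟨a, hle, hlt⟩ := exists_tc_le_lt (k := k) (r := r) (by omega) m
    rw [tc_succ] at hlt
    rcases hle.eq_or_lt with heq | hlt'
    · refine ⟨0, fun _ => a, by simp [heq], by simp, ?_, hk⟩
      by_contra! hak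
      rw [Nat.sub_zero] at hak
      rw [tc_eq_zero hak] at heq
      omega
    · have hk' : 0 < k := by
        rw [Nat.pos_iff_ne_zero]
        rintro rfl
        rw [tc_zero_right] at hlt
        omega
      obtain ⟨s, n, h⟩ := ih (m := m - tc a (k + 1) (r + 1)) (r := r) (by omega) hk' (by omega)
      have hna : n 0 < a - a / (r + 1) :=
        (tc_monotone (by omega)).reflect_lt (h.tc_le.trans_lt (by omega))
      refine ⟨s + 1, fun i => i.casesOn a n, ?_, ?_, by simpa using h.le_last,
        by simpa using h.length_lt⟩
      · rw [Finset.sum_range_succ']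
        simp only [Nat.add_sub_add_right, Nat.sub_zero]
        rw [← h.sum_eq]
        exact (Nat.sub_add_cancel hle).symm
      · rintro (_ | i) hi
        · exact hna
        · simpa using h.lt i (by omega)

/-- Given positive integers `m`, `k`, `r` with `r ≥ k`, there are unique
integers `s ≥ 0` and `n_k, n_{k-1}, …, n_{k-s}` such that
`m = C(n_k, k)_r + C(n_{k-1}, k-1)_{r-1} + ⋯ + C(n_{k-s}, k-s)_{r-s}`, with
`n_{k-i} − ⌊n_{k-i}/(r-i)⌋ > n_{k-i-1}` for all `0 ≤ i < s`, and `n_{k-s} ≥ k-s > 0`.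
Here `n i` denotes `n_{k-i}` for `0 ≤ i ≤ s`. -/
theorem stmt_8 (m k r : ℕ) (hm : 0 < m) (hk : 0 < k) (hkr : k ≤ r) :
    ∃ (s : ℕ) (n : ℕ → ℕ),
      (m = ∑ i ∈ Finset.range (s + 1), tc (n i) (k - i) (r - i)) ∧
      (∀ i, i < s → n (i + 1) < n i - n i / (r - i)) ∧
      (k - s ≤ n s) ∧ (s < k) ∧
      (∀ (s' : ℕ) (n' : ℕ → ℕ),
        (m = ∑ i ∈ Finset.range (s' + 1), tc (n' i) (k - i) (r - i)) →
        (∀ i, i < s' → n' (i + 1) < n' i - n' i / (r - i)) →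
        (k - s' ≤ n' s') → (s' < k) →
        s' = s ∧ ∀ i ≤ s, n' i = n i) := by
  obtain ⟨s, n, h⟩ := exists_isTuranCascade hm hk hkr
  exact ⟨s, n, h.sum_eq, h.lt, h.le_last, h.length_lt, fun s' n' hsum hlt hlast hlen =>
    h.unique ⟨hsum, hlt, hlast, hlen⟩ hkr⟩
end

section
/- Let Δ be a flag complex of dimension d-1 (the clique complex of a simple graph whose largest clique has d vertices). Then there exists a simplicial complex Γ (a family of finite sets closed under taking subsets) together with an assignment of one of d colors to each vertex of Γ such that no two vertices of the same color lie in a common face of Γ, and for every i ≥ 0 the number of faces of Γ on i vertices equals the number of faces of Δ on i vertices. -/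
namespace FlagBalanced

open Finset
open scoped FinsetFamily

/-- The position of a finite set of naturals in the colexicographic order. -/
def weight (A : Finset ℕ) : ℕ := ∑ i ∈ A, 2 ^ i

lemma weight_injective : Function.Injective weight := geomSum_injective le_rfl

lemma weight_lt_weight {A B : Finset ℕ} : weight A < weight B ↔ toColex A < toColex B :=
  geomSum_lt_geomSum_iff_toColex_lt_toColex le_rfl

lemma weight_lt_iff {A B : Finset ℕ} :
    weight A < weight B ↔ ∃ a ∈ B, a ∉ A ∧ ∀ b ∈ A, b ∉ B → b < a :=
  weight_lt_weight.trans Colex.toColex_lt_toColex_iff_exists_forall_lt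

lemma weight_le_iff {A B : Finset ℕ} :
    weight A ≤ weight B ↔ ∀ a ∈ A, a ∉ B → ∃ b ∈ B, b ∉ A ∧ a ≤ b :=
  (geomSum_le_geomSum_iff_toColex_le_toColex le_rfl).trans Colex.toColex_le_toColex

lemma weight_insert {v : ℕ} {A : Finset ℕ} (h : v ∉ A) :
    weight (insert v A) = 2 ^ v + weight A := sum_insert h

lemma weight_lt_two_pow {b : ℕ} {A : Finset ℕ} (h : ∀ a ∈ A, a < b) : weight A < 2 ^ b :=
  Nat.geomSum_lt le_rfl h

lemma two_pow_le_weight {b : ℕ} {A : Finset ℕ} (h : b ∈ A) : 2 ^ b ≤ weight A :=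
  single_le_sum (f := fun i => 2 ^ i) (fun _ _ => Nat.zero_le _) h

lemma weight_image_lt {e : ℕ → ℕ} (he : StrictMono e) {A B : Finset ℕ} :
    weight (A.image e) < weight (B.image e) ↔ weight A < weight B := by
  rw [weight_lt_weight, weight_lt_weight, Colex.toColex_image_lt_toColex_image he]

/-- `F` consists of sets satisfying `P`, and is closed under passing to colex-smaller ones. -/
structure IsInit (P : Finset ℕ → Prop) (F : Finset (Finset ℕ)) : Prop where
  prop : ∀ A ∈ F, P A
  down : ∀ A B, B ∈ F → P A → weight A < weight B → A ∈ F

lemma exists_initial_subset (X : Finset (Finset ℕ)) (n : ℕ) (hn : n ≤ #X) :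
    ∃ Y ⊆ X, #Y = n ∧ ∀ A ∈ X, ∀ B ∈ Y, weight A < weight B → A ∈ Y := by
  obtain ⟨m, hm⟩ := Nat.exists_eq_add_of_le hn
  induction m generalizing n with
  | zero => exact ⟨X, Subset.rfl, hm, fun A hA _ _ _ => hA⟩
  | succ m ih =>
    obtain ⟨Y, hYX, hY, hdown⟩ := ih (n + 1) (by omega) (by omega)
    have hne : Y.Nonempty := card_pos.1 (by omega)
    obtain ⟨M, hM, hmax⟩ := exists_max_image Y weight hne
    refine ⟨Y.erase M, (erase_subset _ _).trans hYX, by rw [card_erase_of_mem hM]; omega, ?_⟩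
    intro A hA B hB hlt
    have hBY := mem_of_mem_erase hB
    refine mem_erase.2 ⟨?_, hdown A hA B hBY hlt⟩
    rintro rfl
    exact absurd (hmax B hBY) (by omega)

lemma exists_isInit {P : Finset ℕ → Prop} {F : Finset (Finset ℕ)} (hF : ∀ A ∈ F, P A)
    {n : ℕ} (hn : n ≤ #F) : ∃ I, IsInit P I ∧ #I = n := by
  classical
  obtain ⟨N, hN⟩ : ∃ N, ∀ A ∈ F, ∀ a ∈ A, a < N := by
    refine ⟨(F.biUnion id).sup id + 1, fun A hA a ha => Nat.lt_succ_of_le ?_⟩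
    exact le_sup (f := id) (mem_biUnion.2 ⟨A, hA, ha⟩)
  set X := (range N).powerset.filter P with hX
  have hFX : F ⊆ X := fun A hA => by
    simp only [hX, mem_filter, mem_powerset]
    exact ⟨fun a ha => mem_range.2 (hN A hA a ha), hF A hA⟩
  obtain ⟨Y, hYX, hY, hdown⟩ := exists_initial_subset X n (hn.trans (card_le_card hFX))
  refine ⟨Y, ⟨fun A hA => (mem_filter.1 (hYX hA)).2, fun A B hB hA hlt => ?_⟩, hY⟩
  refine hdown A (mem_filter.2 ⟨mem_powerset.2 fun a ha => ?_, hA⟩) B hB hlt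
  have hB' := mem_powerset.1 (mem_filter.1 (hYX hB)).1
  have h1 := weight_lt_two_pow (b := N) fun x hx => mem_range.1 (hB' hx)
  have h2 := two_pow_le_weight ha
  exact mem_range.2 ((Nat.pow_lt_pow_iff_right (by norm_num)).1 (by omega : 2 ^ a < 2 ^ N))

lemma IsInit.subset_or_subset {P : Finset ℕ → Prop} {I J : Finset (Finset ℕ)} (hI : IsInit P I)
    (hJ : IsInit P J) : I ⊆ J ∨ J ⊆ I := by
  by_contra! h
  obtain ⟨A, hA, hA'⟩ := not_subset.1 h.1
  obtain ⟨B, hB, hB'⟩ := not_subset.1 h.2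
  rcases lt_trichotomy (weight A) (weight B) with h | h | h
  · exact hA' (hJ.down A B hB (hI.prop A hA) h)
  · exact hA' (weight_injective h ▸ hB)
  · exact hB' (hI.down B A hA (hJ.prop B hB) h)

lemma IsInit.subset_of_card_le {P : Finset ℕ → Prop} {I J : Finset (Finset ℕ)} (hI : IsInit P I)
    (hJ : IsInit P J) (h : #I ≤ #J) : I ⊆ J := by
  rcases hI.subset_or_subset hJ with h' | h'
  · exact h'
  · exact (eq_of_subset_of_card_le h' h).symm.subset

lemma IsInit.sum_weight_lt {P : Finset ℕ → Prop} {I F : Finset (Finset ℕ)} (hI : IsInit P I)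
    (hF : ∀ A ∈ F, P A) (hc : #I = #F) (hne : I ≠ F) :
    ∑ A ∈ I, weight A < ∑ A ∈ F, weight A := by
  have hc' : #(I \ F) = #(F \ I) := by
    have h1 := card_sdiff_add_card_inter I F
    have h2 := card_sdiff_add_card_inter F I
    rw [inter_comm] at h2
    omega
  have hpos : (I \ F).Nonempty := by
    rw [sdiff_nonempty]
    exact fun h => hne (eq_of_subset_of_card_le h hc.symm.le)
  have hpos' : (F \ I).Nonempty := card_pos.1 (hc' ▸ card_pos.2 hpos)
  obtain ⟨M, hM, hmax⟩ := exists_max_image (I \ F) weight hpos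
  have hlt : ∀ B ∈ F \ I, weight M < weight B := fun B hB => by
    rw [mem_sdiff] at hB hM
    by_contra hcon
    rcases (not_lt.1 hcon).lt_or_eq with h | h
    · exact hB.2 (hI.down B M hM.1 (hF B hB.1) h)
    · exact hB.2 (weight_injective h ▸ hM.1)
  have h1 : ∑ A ∈ I \ F, weight A ≤ #(I \ F) * weight M := by
    simpa using sum_le_card_nsmul _ _ _ hmax
  have h2 : ∑ A ∈ F \ I, weight A > #(F \ I) * weight M := by
    have := sum_lt_sum_of_nonempty hpos' hlt
    simpa using this
  rw [← sum_inter_add_sum_sdiff I F, ← sum_inter_add_sum_sdiff F I, inter_comm F I]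
  rw [hc'] at h1
  omega

lemma IsInit.sum_weight_le {P : Finset ℕ → Prop} {I F : Finset (Finset ℕ)} (hI : IsInit P I)
    (hF : ∀ A ∈ F, P A) (hc : #I = #F) : ∑ A ∈ I, weight A ≤ ∑ A ∈ F, weight A := by
  rcases eq_or_ne I F with rfl | hne
  · exact le_rfl
  · exact (hI.sum_weight_lt hF hc hne).le

/-! ### Families assembled from links -/

/-- The family with deletion `D` and links `L v`, `v ∈ V`. -/
def assemble (D : Finset (Finset ℕ)) (V : Finset ℕ) (L : ℕ → Finset (Finset ℕ)) :
    Finset (Finset ℕ) :=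
  D ∪ V.biUnion fun v => (L v).image (insert v)

/-- All members of `F` are disjoint from `V`. -/
def Avoids (V : Finset ℕ) (F : Finset (Finset ℕ)) : Prop := ∀ A ∈ F, ∀ v ∈ V, v ∉ A

lemma mem_assemble {D : Finset (Finset ℕ)} {V : Finset ℕ} {L : ℕ → Finset (Finset ℕ)}
    {A : Finset ℕ} :
    A ∈ assemble D V L ↔ A ∈ D ∨ ∃ v ∈ V, ∃ B ∈ L v, insert v B = A := by
  simp [assemble]

lemma sum_assemble {D : Finset (Finset ℕ)} {V : Finset ℕ} {L : ℕ → Finset (Finset ℕ)}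
    (hD : Avoids V D) (hL : ∀ v ∈ V, Avoids V (L v)) (f : Finset ℕ → ℕ) :
    ∑ A ∈ assemble D V L, f A = ∑ A ∈ D, f A + ∑ v ∈ V, ∑ A ∈ L v, f (insert v A) := by
  rw [assemble, sum_union, sum_biUnion]
  · congr 1
    refine sum_congr rfl fun v hv => sum_image fun A hA B hB h => ?_
    rw [← erase_insert (hL v hv A hA v hv), h, erase_insert (hL v hv B hB v hv)]
  · intro u hu v hv huv
    refine disjoint_left.2 fun A hA hA' => ?_
    obtain ⟨B, hB, rfl⟩ := mem_image.1 hA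
    obtain ⟨C, hC, h⟩ := mem_image.1 hA'
    have : u ∈ insert v C := h ▸ mem_insert_self u B
    rcases mem_insert.1 this with h' | h'
    · exact huv h'
    · exact hL v hv C hC u hu h'
  · refine disjoint_left.2 fun A hA hA' => ?_
    obtain ⟨v, hv, hA'⟩ := mem_biUnion.1 hA'
    obtain ⟨B, hB, rfl⟩ := mem_image.1 hA'
    exact hD _ hA v hv (mem_insert_self v B)

lemma card_assemble {D : Finset (Finset ℕ)} {V : Finset ℕ} {L : ℕ → Finset (Finset ℕ)}
    (hD : Avoids V D) (hL : ∀ v ∈ V, Avoids V (L v)) :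
    #(assemble D V L) = #D + ∑ v ∈ V, #(L v) := by
  simpa using sum_assemble hD hL fun _ => 1

lemma Avoids.shadow {V : Finset ℕ} {F : Finset (Finset ℕ)} (h : Avoids V F) : Avoids V (∂ F) := by
  intro A hA v hv hvA
  obtain ⟨B, hB, hAB⟩ := exists_subset_of_mem_shadow hA
  exact h B hB v hv (hAB hvA)

lemma Avoids.union {V : Finset ℕ} {F G : Finset (Finset ℕ)} (hF : Avoids V F) (hG : Avoids V G) :
    Avoids V (F ∪ G) := fun A hA => (mem_union.1 hA).elim (hF A) (hG A)

lemma Avoids.biUnion {V : Finset ℕ} {L : ℕ → Finset (Finset ℕ)} (hL : ∀ v ∈ V, Avoids V (L v)) :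
    Avoids V (V.biUnion L) := fun A hA => by
  obtain ⟨v, hv, hA⟩ := mem_biUnion.1 hA
  exact hL v hv A hA

lemma shadow_assemble {D : Finset (Finset ℕ)} {V : Finset ℕ} {L : ℕ → Finset (Finset ℕ)}
    (hL : ∀ v ∈ V, Avoids V (L v)) :
    ∂ (assemble D V L) = assemble (∂ D ∪ V.biUnion L) V fun v => ∂ (L v) := by
  ext A
  simp only [mem_shadow_iff, mem_assemble, mem_union, mem_biUnion]
  constructor
  · rintro ⟨B, hB | ⟨v, hv, C, hC, rfl⟩, a, ha, rfl⟩
    · exact Or.inl (Or.inl ⟨B, hB, a, ha, rfl⟩)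
    · have hvC := hL v hv C hC v hv
      rcases eq_or_ne a v with rfl | hav
      · exact Or.inl (Or.inr ⟨a, hv, by rwa [erase_insert hvC]⟩)
      · refine Or.inr ⟨v, hv, C.erase a, ⟨C, hC, a, (mem_insert.1 ha).resolve_left hav, rfl⟩, ?_⟩
        rw [erase_insert_of_ne hav.symm]
  · rintro ((⟨B, hB, a, ha, rfl⟩ | ⟨v, hv, hA⟩) | ⟨v, hv, B, ⟨C, hC, a, ha, rfl⟩, rfl⟩)
    · exact ⟨B, Or.inl hB, a, ha, rfl⟩
    · exact ⟨insert v A, Or.inr ⟨v, hv, A, hA, rfl⟩, v, mem_insert_self _ _,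
        erase_insert (hL v hv A hA v hv)⟩
    · have hvC := hL v hv C hC v hv
      refine ⟨insert v C, Or.inr ⟨v, hv, C, hC, rfl⟩, a, mem_insert_of_mem ha, ?_⟩
      rw [erase_insert_of_ne]
      rintro rfl
      exact hvC ha

lemma card_shadow_assemble {D : Finset (Finset ℕ)} {V : Finset ℕ} {L : ℕ → Finset (Finset ℕ)}
    (hD : Avoids V D) (hL : ∀ v ∈ V, Avoids V (L v)) :
    #(∂ (assemble D V L)) = #(∂ D ∪ V.biUnion L) + ∑ v ∈ V, #(∂ (L v)) := by
  rw [shadow_assemble hL, card_assemble (hD.shadow.union (Avoids.biUnion hL))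
    fun v hv => (hL v hv).shadow]

lemma assemble_memberSubfamily {F : Finset (Finset ℕ)} {V : Finset ℕ}
    (D : Finset (Finset ℕ)) (hD : ∀ A, A ∈ D ↔ A ∈ F ∧ ∀ v ∈ V, v ∉ A) :
    assemble D V (fun v => F.memberSubfamily v) = F := by
  ext A
  simp only [mem_assemble, hD, mem_memberSubfamily]
  constructor
  · rintro (h | ⟨v, hv, B, hB, rfl⟩)
    · exact h.1
    · exact hB.1
  · intro hA
    by_cases h : ∀ v ∈ V, v ∉ A
    · exact Or.inl ⟨hA, h⟩
    · push Not at h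
      obtain ⟨v, hv, hvA⟩ := h
      exact Or.inr ⟨v, hv, A.erase v, ⟨by rwa [insert_erase hvA], by simp⟩, insert_erase hvA⟩

lemma shadow_image {e : ℕ → ℕ} (he : Function.Injective e) (F : Finset (Finset ℕ)) :
    ∂ (F.image (image e)) = (∂ F).image (image e) := by
  ext A
  simp only [mem_shadow_iff, mem_image]
  constructor
  · rintro ⟨_, ⟨B, hB, rfl⟩, _, ha, rfl⟩
    obtain ⟨a, haB, rfl⟩ := mem_image.1 ha
    exact ⟨_, ⟨B, hB, a, haB, rfl⟩, image_erase he B a⟩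
  · rintro ⟨_, ⟨B, hB, a, ha, rfl⟩, rfl⟩
    exact ⟨_, ⟨B, hB, rfl⟩, e a, mem_image_of_mem e ha, (image_erase he B a).symm⟩

/-- `A` has `k` elements, which are pairwise incongruent modulo `d`. -/
def Rainbow (d k : ℕ) (A : Finset ℕ) : Prop :=
  #A = k ∧ ∀ x ∈ A, ∀ y ∈ A, x % d = y % d → x = y

lemma Rainbow.subset {d k : ℕ} {A B : Finset ℕ} (hA : Rainbow d k A) (h : B ⊆ A) :
    Rainbow d #B B := ⟨rfl, fun x hx y hy => hA.2 x (h hx) y (h hy)⟩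

lemma Rainbow.erase {d k : ℕ} {A : Finset ℕ} {v : ℕ} (hA : Rainbow d (k + 1) A) (hv : v ∈ A) :
    Rainbow d k (A.erase v) := by
  have := hA.subset (erase_subset v A)
  rwa [card_erase_of_mem hv, hA.1] at this

lemma Rainbow.insert {d k : ℕ} {A : Finset ℕ} {v : ℕ} (hA : Rainbow d k A)
    (hv : ∀ a ∈ A, a % d ≠ v % d) : Rainbow d (k + 1) (insert v A) := by
  have hvA : v ∉ A := fun h => hv v h rfl
  refine ⟨by rw [card_insert_of_notMem hvA, hA.1], fun x hx y hy hxy => ?_⟩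
  rcases mem_insert.1 hx with rfl | hx <;> rcases mem_insert.1 hy with rfl | hy
  · rfl
  · exact absurd hxy.symm (hv y ‹_›)
  · exact absurd hxy (hv x ‹_›)
  · exact hA.2 x ‹_› y ‹_› hxy

lemma Rainbow.of_insert {d k : ℕ} {A : Finset ℕ} {v : ℕ}
    (hA : Rainbow d (k + 1) (Insert.insert v A)) (hv : v ∉ A) : Rainbow d k A := by
  simpa [erase_insert hv] using hA.erase (mem_insert_self v A)

lemma Rainbow.card_image {d k : ℕ} {A : Finset ℕ} (hA : Rainbow d k A) :
    #(A.image (· % d)) = k := by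
  rw [card_image_of_injOn, hA.1]
  exact fun x hx y hy => hA.2 x hx y hy

lemma Rainbow.le {d k : ℕ} {A : Finset ℕ} (hd : 0 < d) (hA : Rainbow d k A) : k ≤ d := by
  refine hA.card_image.symm.trans_le ((card_le_card fun x hx => ?_).trans (card_range d).le)
  obtain ⟨a, -, rfl⟩ := mem_image.1 hx
  exact mem_range.2 (Nat.mod_lt _ hd)

lemma rainbow_range {d k : ℕ} (h : k ≤ d) : Rainbow d k (range k) := by
  refine ⟨card_range k, fun x hx y hy hxy => ?_⟩
  rw [mem_range] at hx hy
  rwa [Nat.mod_eq_of_lt (by omega), Nat.mod_eq_of_lt (by omega)] at hxy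

lemma Rainbow.exists_new_color {d j k : ℕ} {X A : Finset ℕ} (hX : Rainbow d j X)
    (hA : Rainbow d k A) (hjk : j < k) : ∃ a ∈ A, ∀ x ∈ X, x % d ≠ a % d := by
  have : #(X.image (· % d)) < #(A.image (· % d)) := by rwa [hX.card_image, hA.card_image]
  obtain ⟨c, hc, hc'⟩ := exists_mem_notMem_of_card_lt_card this
  obtain ⟨a, ha, rfl⟩ := mem_image.1 hc
  exact ⟨a, ha, fun x hx h => hc' (mem_image.2 ⟨x, hx, h⟩)⟩

lemma Rainbow.exists_extension {d j k : ℕ} {X A : Finset ℕ} (hX : Rainbow d j X)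
    (hA : Rainbow d k A) (hjk : j ≤ k) : ∃ C, X ⊆ C ∧ C ⊆ X ∪ A ∧ Rainbow d k C := by
  induction hjk using Nat.decreasingInduction generalizing X with
  | self => exact ⟨X, Subset.rfl, subset_union_left, hX⟩
  | of_succ j hj ih =>
    obtain ⟨a, ha, hnew⟩ := hX.exists_new_color hA hj
    obtain ⟨C, hC, hC', hC''⟩ := ih (hX.insert hnew)
    refine ⟨C, (subset_insert _ _).trans hC, fun c hc => ?_, hC''⟩
    have := hC' hc
    simp only [mem_union, mem_insert] at this ⊢
    rcases this with (rfl | h) | h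
    · exact Or.inr ha
    · exact Or.inl h
    · exact Or.inr h

lemma rainbow_shadow {d k : ℕ} {F : Finset (Finset ℕ)} (hF : ∀ A ∈ F, Rainbow d (k + 1) A) :
    ∀ A ∈ ∂ F, Rainbow d k A := by
  intro A hA
  obtain ⟨B, hB, b, hb, rfl⟩ := mem_shadow_iff.1 hA
  exact (hF B hB).erase hb

lemma weight_insert_lt {a y x : ℕ} {C C' : Finset ℕ} (hx : x ∈ C') (hxC : x ∉ C)
    (hmax : ∀ b ∈ C, b ∉ C' → b < x) (hyC' : y ∉ C') (ha : a ∉ C)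
    (h : a < x ∨ (a ≤ x ∧ x < y)) : weight (insert a C) < weight (insert y C') := by
  rw [weight_lt_iff]
  by_cases hyx : x < y
  · refine ⟨y, mem_insert_self _ _, ?_, ?_⟩
    · rw [mem_insert, not_or]
      exact ⟨by omega, fun hy => by have := hmax y hy hyC'; omega⟩
    · intro b hb hb'
      rw [mem_insert, not_or] at hb'
      rcases mem_insert.1 hb with rfl | hb
      · omega
      · have := hmax b hb hb'.2
        omega
  · have hax : a < x := by omega
    refine ⟨x, mem_insert_of_mem hx, ?_, ?_⟩
    · rw [mem_insert, not_or]
      exact ⟨by omega, hxC⟩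
    · intro b hb hb'
      rw [mem_insert, not_or] at hb'
      rcases mem_insert.1 hb with rfl | hb
      · exact hax
      · exact hmax b hb hb'.2

lemma exists_insert_le {d k : ℕ} {C C' : Finset ℕ} {y : ℕ} (hd : 0 < d) (hC : Rainbow d k C)
    (hy : y ∉ C') (hA : Rainbow d (k + 1) (insert y C')) (hlt : weight C < weight C') :
    ∃ c, (∀ a ∈ C, a % d ≠ c % d) ∧ weight (insert c C) ≤ weight (insert y C') := by
  obtain ⟨x, hx, hxC, hmax⟩ := weight_lt_iff.1 hlt
  obtain ⟨a, ha, hnew⟩ := hC.exists_new_color hA (Nat.lt_succ_self k)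
  have haC : a ∉ C := fun h => hnew a h rfl
  rcases mem_insert.1 ha with rfl | haC'
  · refine ⟨a, hnew, ?_⟩
    rw [weight_insert haC, weight_insert hy]
    omega
  obtain ⟨x, hx, hxC, hmax, htop⟩ : ∃ x ∈ C', x ∉ C ∧ (∀ b ∈ C, b ∉ C' → b < x) ∧
      ∀ b ∈ C', b ∉ C → b ≤ x := by
    have hne : (C' \ C).Nonempty := ⟨x, mem_sdiff.2 ⟨hx, hxC⟩⟩
    refine ⟨(C' \ C).max' hne, ?_, ?_, ?_, ?_⟩
    · exact (mem_sdiff.1 (max'_mem _ hne)).1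
    · exact (mem_sdiff.1 (max'_mem _ hne)).2
    · intro b hb hb'
      exact (hmax b hb hb').trans_le (le_max' _ _ (mem_sdiff.2 ⟨hx, hxC⟩))
    · exact fun b hb hb' => le_max' _ _ (mem_sdiff.2 ⟨hb, hb'⟩)
  have hax := htop a haC' haC
  by_cases h : a < x ∨ (a ≤ x ∧ x < y)
  · exact ⟨a, hnew, (weight_insert_lt hx hxC hmax hy haC h).le⟩
  obtain rfl : a = x := by omega
  have hya : y < a := by
    have : y ≠ a := fun h => hy (h ▸ hx)
    omega
  by_cases had : d ≤ a
  · have hmod : (a - d) % d = a % d := (Nat.mod_eq_sub_mod had).symm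
    have hnew' : ∀ b ∈ C, b % d ≠ (a - d) % d := by rwa [hmod]
    refine ⟨a - d, hnew', (weight_insert_lt hx hxC hmax hy (fun h => hnew' _ h rfl) ?_).le⟩
    omega
  · by_cases heq : insert a C = insert y C'
    · exact ⟨a, hnew, by rw [heq]⟩
    have hcard : #(insert y C') = #(insert a C) := by
      rw [hA.1, card_insert_of_notMem haC, hC.1]
    obtain ⟨z, hz, hz'⟩ : ∃ z ∈ insert y C', z ∉ insert a C := by
      by_contra! hcon
      exact heq (eq_of_subset_of_card_le hcon hcard.symm.le).symm
    rw [mem_insert, not_or] at hz'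
    have hza : z < a := by
      rcases mem_insert.1 hz with rfl | hz
      · exact hya
      · have := htop z hz hz'.2
        omega
    have hznew : ∀ b ∈ C, b % d ≠ z % d := by
      intro b hb hbz
      have hbne : b ≠ z := fun h => hz'.2 (h ▸ hb)
      have hbd : d ≤ b := by
        by_contra hbd
        rw [Nat.mod_eq_of_lt (by omega), Nat.mod_eq_of_lt (by omega)] at hbz
        exact hbne hbz
      have hbC' : b ∈ C' := by
        by_contra hbC'
        have := hmax b hb hbC'
        omega
      exact hbne (hA.2 b (mem_insert_of_mem hbC') z hz hbz)
    exact ⟨z, hznew, (weight_insert_lt hx hxC hmax hy hz'.2 (Or.inl hza)).le⟩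

lemma IsInit.shadow {d k : ℕ} {I : Finset (Finset ℕ)} (hd : 0 < d)
    (hI : IsInit (Rainbow d (k + 1)) I) :
    IsInit (Rainbow d k) (∂ I) := by
  refine ⟨rainbow_shadow hI.prop, fun C C' hC' hC hlt => ?_⟩
  obtain ⟨y, hy, hA⟩ := mem_shadow_iff_insert_mem.1 hC'
  obtain ⟨c, hc, hle⟩ := exists_insert_le hd hC hy (hI.prop _ hA) hlt
  refine mem_shadow_iff_insert_mem.2 ⟨c, fun h => hc c h rfl, ?_⟩
  rcases hle.lt_or_eq with h | h
  · exact hI.down _ _ hA (hC.insert hc) h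
  · rwa [weight_injective h]

open scoped Classical in
/-- The rainbow `k`-sets contained in `{0, …, n - 1}`. -/
noncomputable def full (d k n : ℕ) : Finset (Finset ℕ) := (range n).powerset.filter (Rainbow d k)

lemma mem_full {d k n : ℕ} {A : Finset ℕ} :
    A ∈ full d k n ↔ (∀ a ∈ A, a < n) ∧ Rainbow d k A := by
  simp [full, subset_iff]

lemma isInit_of_weight_lt {P : Finset ℕ → Prop} {F : Finset (Finset ℕ)} {n : ℕ}
    (h : ∀ A, A ∈ F ↔ (∀ a ∈ A, a < n) ∧ P A) : IsInit P F := by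
  refine ⟨fun A hA => ((h A).1 hA).2, fun A B hB hA hlt => (h A).2 ⟨fun a ha => ?_, hA⟩⟩
  have h1 := weight_lt_two_pow ((h B).1 hB).1
  have h2 := two_pow_le_weight ha
  exact (Nat.pow_lt_pow_iff_right (by norm_num)).1 (by omega : 2 ^ a < 2 ^ n)

lemma isInit_full (d k n : ℕ) : IsInit (Rainbow d k) (full d k n) :=
  isInit_of_weight_lt fun _ => mem_full

lemma full_mono {d k m n : ℕ} (h : m ≤ n) : full d k m ⊆ full d k n := fun A hA => by
  rw [mem_full] at hA ⊢
  exact ⟨fun a ha => (hA.1 a ha).trans_le h, hA.2⟩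

/-- The colored Kruskal–Katona property: initial families minimize the shadow. -/
def Minimizes (P : Finset ℕ → Prop) : Prop :=
  ∀ F : Finset (Finset ℕ), (∀ A ∈ F, P A) → ∀ I, IsInit P I → #I = #F → #(∂ I) ≤ #(∂ F)

lemma minimizes_of_exists {P : Finset ℕ → Prop}
    (h : ∀ F : Finset (Finset ℕ), (∀ A ∈ F, P A) → ∃ I, IsInit P I ∧ #I = #F ∧ #(∂ I) ≤ #(∂ F)) :
    Minimizes P := fun F hF I hI hc => by
  obtain ⟨J, hJ, hJc, hle⟩ := h F hF
  rwa [(eq_of_subset_of_card_le (hI.subset_of_card_le hJ (by omega)) (by omega) : I = J)]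

lemma Minimizes.exists_isInit {P : Finset ℕ → Prop} (h : Minimizes P) {F : Finset (Finset ℕ)}
    (hF : ∀ A ∈ F, P A) : ∃ I, IsInit P I ∧ #I = #F ∧ #(∂ I) ≤ #(∂ F) := by
  obtain ⟨I, hI, hc⟩ := FlagBalanced.exists_isInit hF le_rfl
  exact ⟨I, hI, hc, h F hF I hI hc⟩

lemma minimizes_zero (d : ℕ) : Minimizes (Rainbow d 0) := by
  intro F hF I hI hc
  have : ∂ I = ∅ := by
    refine eq_empty_of_forall_notMem fun A hA => ?_
    obtain ⟨B, hB, b, hb, -⟩ := mem_shadow_iff.1 hA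
    have := (hI.prop B hB).1
    simp_all
  simp [this]

lemma minimizes_one (d : ℕ) : Minimizes (Rainbow d 1) := by
  intro F hF I hI hc
  have hsub : ∂ I ⊆ {∅} := fun A hA => by
    have := (rainbow_shadow (k := 0) hI.prop A hA).1
    simpa using this
  rcases F.eq_empty_or_nonempty with rfl | ⟨A, hA⟩
  · have : I = ∅ := by simpa using hc
    simp [this]
  · have hne : A.Nonempty := card_pos.1 (by rw [(hF A hA).1]; norm_num)
    obtain ⟨a, ha⟩ := hne
    calc #(∂ I) ≤ 1 := card_le_card hsub
      _ ≤ #(∂ F) := card_pos.2 ⟨_, erase_mem_shadow hA ha⟩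

/-! ### Pairs: Turán's bound -/

lemma card_mod_eq_le {d : ℕ} (hd : 0 < d) (n : ℕ) :
    #((range n).filter fun i => i % d = n % d) = n / d := by
  rw [← Nat.count_eq_card_filter_range]
  have h := Nat.count_modEq_card (v := n) (r := d) n hd
  simp only [lt_irrefl, if_false, add_zero] at h
  convert h
  exact Iff.rfl

open scoped Classical in
lemma card_pairs_le {d : ℕ} (hd : 0 < d) (W : Finset ℕ) :
    #(W.powerset.filter (Rainbow d 2)) ≤ #(full d 2 #W) := by
  have key : ∀ (U : Finset ℕ) (v : ℕ), v ∉ U →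
      #((insert v U).powerset.filter (Rainbow d 2)) =
        #(U.powerset.filter (Rainbow d 2)) + (#U - #(U.filter fun u => u % d = v % d)) := by
    intro U v hv
    have h1 : (insert v U).powerset.filter (Rainbow d 2) =
        assemble (U.powerset.filter (Rainbow d 2)) {v}
          (fun _ => (U.filter fun u => ¬ u % d = v % d).image singleton) := by
      ext A
      simp only [mem_filter, mem_powerset, mem_assemble, mem_singleton, exists_eq_left, mem_image]
      constructor
      · rintro ⟨hA, hR⟩
        by_cases hvA : v ∈ A
        · right
          obtain ⟨u, hu⟩ := card_eq_one.1 (hR.erase hvA).1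
          have huA : u ∈ A.erase v := hu ▸ mem_singleton_self u
          rw [mem_erase] at huA
          refine ⟨{u}, ⟨u, ⟨(mem_insert.1 (hA huA.2)).resolve_left huA.1, fun h => ?_⟩, rfl⟩, ?_⟩
          · exact huA.1 (hR.2 u huA.2 v hvA h)
          · rw [← hu, insert_erase hvA]
        · exact Or.inl ⟨(subset_insert_iff_of_notMem hvA).1 hA, hR⟩
      · rintro (⟨hA, hR⟩ | ⟨_, ⟨u, ⟨hu, huv⟩, rfl⟩, rfl⟩)
        · exact ⟨hA.trans (subset_insert _ _), hR⟩
        · refine ⟨insert_subset_insert _ (singleton_subset_iff.2 hu), ?_⟩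
          exact Rainbow.insert (k := 1) ⟨card_singleton u, by simp⟩ (by simpa using huv)
    have h2 := card_filter_add_card_filter_not (s := U) fun u => u % d = v % d
    rw [h1, card_assemble, sum_singleton, card_image_of_injective _ singleton_injective]
    · omega
    · intro A hA u hu huA
      rw [mem_singleton] at hu
      subst hu
      exact hv (mem_powerset.1 (mem_filter.1 hA).1 huA)
    · intro _ _ A hA u hu huA
      rw [mem_singleton] at hu
      subst hu
      obtain ⟨w, hw, rfl⟩ := mem_image.1 hA
      rw [mem_singleton] at huA
      subst huA
      exact hv (mem_filter.1 hw).1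
  induction hn : #W generalizing W with
  | zero =>
    rw [card_eq_zero] at hn
    subst hn
    simp [full]
  | succ n ih =>
    have hmaps : ∀ a ∈ W, a % d ∈ range d := fun a _ => mem_range.2 (Nat.mod_lt _ hd)
    obtain ⟨c, -, hc⟩ := exists_lt_card_fiber_of_mul_lt_card_of_maps_to (n := n / d) hmaps (by
      rw [card_range, hn]
      exact Nat.lt_succ_of_le (Nat.mul_div_le n d))
    obtain ⟨v, hv⟩ := card_pos.1 (Nat.zero_lt_of_lt hc)
    rw [mem_filter] at hv
    obtain ⟨hvW, rfl⟩ := hv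
    have hcard : #(W.erase v) = n := by rw [card_erase_of_mem hvW, hn]; rfl
    have h1 := key (W.erase v) v (by simp)
    have h2 := key (range n) n (by simp)
    rw [insert_erase hvW] at h1
    rw [← range_add_one] at h2
    rw [card_mod_eq_le hd, card_range] at h2
    have h3 := ih (W.erase v) hcard
    have h4 : #(W.filter fun a => a % d = v % d) =
        #((W.erase v).filter fun a => a % d = v % d) + 1 := by
      rw [filter_erase, card_erase_add_one (by simp [hvW])]
    simp only [full] at h3 ⊢
    rw [h1, h2, hcard]
    omega

lemma minimizes_two {d : ℕ} (hd : 0 < d) : Minimizes (Rainbow d 2) := by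
  classical
  intro F hF I hI hc
  set W := (∂ F).biUnion id with hW
  have hsing : ∀ A ∈ ∂ F, ∃ a, A = {a} := fun A hA => by
    exact card_eq_one.1 (rainbow_shadow (k := 1) hF A hA).1
  have hWc : #W ≤ #(∂ F) := by
    refine (card_biUnion_le).trans ?_
    rw [card_eq_sum_ones]
    refine sum_le_sum fun A hA => ?_
    obtain ⟨a, rfl⟩ := hsing A hA
    simp
  have hFW : F ⊆ W.powerset.filter (Rainbow d 2) := fun A hA => by
    refine mem_filter.2 ⟨mem_powerset.2 fun a ha => ?_, hF A hA⟩
    have hAe : 0 < #(A.erase a) := by rw [card_erase_of_mem ha, (hF A hA).1]; norm_num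
    obtain ⟨b, hb⟩ := card_pos.1 hAe
    rw [mem_erase] at hb
    exact mem_biUnion.2 ⟨A.erase b, erase_mem_shadow hA hb.2, mem_erase.2 ⟨hb.1.symm, ha⟩⟩
  have hle : #I ≤ #(full d 2 #W) := hc.trans_le ((card_le_card hFW).trans (card_pairs_le hd W))
  have hIf := hI.subset_of_card_le (isInit_full d 2 #W) hle
  refine le_trans ?_ hWc
  rw [← card_range #W, ← card_image_of_injective (range #W) (singleton_injective)]
  refine card_le_card fun A hA => ?_
  obtain ⟨a, rfl⟩ := card_eq_one.1 (rainbow_shadow (k := 1) hI.prop A hA).1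
  obtain ⟨B, hB, hAB⟩ := exists_subset_of_mem_shadow hA
  exact mem_image_of_mem _ (mem_range.2 ((mem_full.1 (hIf hB)).1 a (hAB (mem_singleton_self a))))

/-! ### Packing two families -/

/-- The order-reversing involution of `{0, …, n - 1}`. -/
def reflect (n i : ℕ) : ℕ := if i < n then n - 1 - i else i

lemma reflect_injective (n : ℕ) : Function.Injective (reflect n) := by
  intro i j h
  unfold reflect at h
  split_ifs at h <;> omega

lemma image_reflect_mem_full {d k n : ℕ} {A : Finset ℕ} (hA : A ∈ full d k n) :
    A.image (reflect n) ∈ full d k n := by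
  rw [mem_full] at hA ⊢
  refine ⟨fun a ha => ?_, by rw [card_image_of_injective _ (reflect_injective n), hA.2.1], ?_⟩
  · obtain ⟨b, hb, rfl⟩ := mem_image.1 ha
    have := hA.1 b hb
    simp only [reflect, this, if_true]
    omega
  · intro x hx y hy hxy
    obtain ⟨a, ha, rfl⟩ := mem_image.1 hx
    obtain ⟨b, hb, rfl⟩ := mem_image.1 hy
    have ha' := hA.1 a ha
    have hb' := hA.1 b hb
    simp only [reflect, ha', hb', if_true] at hxy ⊢
    have : a % d = b % d := by
      have h1 : n - 1 - a + (a + b) ≡ n - 1 - b + (a + b) [MOD d] := Nat.ModEq.add_right _ hxy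
      rw [show n - 1 - a + (a + b) = n - 1 + b by omega,
        show n - 1 - b + (a + b) = n - 1 + a by omega] at h1
      exact (Nat.ModEq.add_left_cancel' _ h1).symm
    rw [hA.2.2 a ha b hb this]

lemma weight_range_le {k : ℕ} {A : Finset ℕ} (hA : #A = k) : weight (range k) ≤ weight A := by
  rw [weight_le_iff]
  intro a ha haA
  have : 0 < #(A \ range k) := by
    have h1 := card_sdiff_add_card_inter A (range k)
    have h2 := card_sdiff_add_card_inter (range k) A
    rw [inter_comm, card_range] at h2
    have : 0 < #(range k \ A) := card_pos.2 ⟨a, mem_sdiff.2 ⟨ha, haA⟩⟩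
    omega
  obtain ⟨b, hb⟩ := card_pos.1 this
  rw [mem_sdiff, mem_range] at hb
  exact ⟨b, hb.1, by rw [mem_range]; exact hb.2, by rw [mem_range] at ha; omega⟩

lemma weight_le_image_reflect {k n : ℕ} {A : Finset ℕ} (hA : #A = k) (hn : ∀ a ∈ A, a < n) :
    weight A ≤ weight ((range k).image (reflect n)) := by
  have hkn : k ≤ n := by
    rw [← hA, ← card_range n]
    exact card_le_card fun a ha => mem_range.2 (hn a ha)
  have hmem : ∀ b, b ∈ (range k).image (reflect n) ↔ n - k ≤ b ∧ b < n := by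
    intro b
    rw [mem_image]
    constructor
    · rintro ⟨i, hi, rfl⟩
      rw [mem_range] at hi
      simp only [reflect, show i < n by omega, if_true]
      omega
    · rintro ⟨h1, h2⟩
      refine ⟨n - 1 - b, mem_range.2 (by omega), ?_⟩
      simp only [reflect, show n - 1 - b < n by omega, if_true]
      omega
  have hc : #((range k).image (reflect n)) = k := by
    rw [card_image_of_injective _ (reflect_injective n), card_range]
  generalize (range k).image (reflect n) = P at hmem hc
  rw [weight_le_iff]
  intro a ha haP
  have : 0 < #(P \ A) := by
    have h1 := card_sdiff_add_card_inter A P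
    have h2 := card_sdiff_add_card_inter P A
    rw [inter_comm] at h2
    have : 0 < #(A \ P) := card_pos.2 ⟨a, mem_sdiff.2 ⟨ha, haP⟩⟩
    omega
  obtain ⟨b, hb⟩ := card_pos.1 this
  rw [mem_sdiff] at hb
  refine ⟨b, hb.1, hb.2, ?_⟩
  have h1 := (hmem b).1 hb.1
  have h2 := hn a ha
  rw [hmem] at haP
  omega

/-- Two families of size at most that of `full d k n` can be replaced by initial families, one of
which is full or the other one empty, without increasing the total size of the shadows. -/
lemma Minimizes.exists_packing {d k n : ℕ} (hd : 0 < d) (h : Minimizes (Rainbow d k))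
    {G₁ G₂ : Finset (Finset ℕ)} (hG₁ : ∀ A ∈ G₁, Rainbow d k A) (hG₂ : ∀ A ∈ G₂, Rainbow d k A)
    (hc₁ : #G₁ ≤ #(full d k n)) (hc₂ : #G₂ ≤ #(full d k n)) :
    ∃ J₁ J₂, IsInit (Rainbow d k) J₁ ∧ IsInit (Rainbow d k) J₂ ∧ J₁ ⊆ full d k n ∧
      #J₁ + #J₂ = #G₁ + #G₂ ∧ #(∂ J₁) + #(∂ J₂) ≤ #(∂ G₁) + #(∂ G₂) ∧ #J₂ ≤ #G₂ ∧
      (J₁ = full d k n ∨ J₂ = ∅) := by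
  induction hm : #G₂ using Nat.strong_induction_on generalizing G₁ G₂ with
  | _ m ih =>
  subst hm
  obtain ⟨J₁, hJ₁, hJ₁c, hJ₁s⟩ := h.exists_isInit hG₁
  obtain ⟨J₂, hJ₂, hJ₂c, hJ₂s⟩ := h.exists_isInit hG₂
  have hsub₁ := hJ₁.subset_of_card_le (isInit_full d k n) (by omega)
  have hsub₂ := hJ₂.subset_of_card_le (isInit_full d k n) (by omega)
  by_cases hdone : J₁ = full d k n ∨ J₂ = ∅
  · exact ⟨J₁, J₂, hJ₁, hJ₂, hsub₁, by omega, by omega, by omega, hdone⟩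
  rw [not_or] at hdone
  obtain ⟨B, hB⟩ := nonempty_iff_ne_empty.2 hdone.2
  have hkd := (hJ₂.prop B hB).le hd
  have hfirst : range k ∈ J₂ := by
    rcases (weight_range_le (hJ₂.prop B hB).1).lt_or_eq with hlt | heq
    · exact hJ₂.down _ _ hB (rainbow_range hkd) hlt
    · rwa [weight_injective heq]
  set K := J₂.image (image (reflect n)) with hK
  have hKc : #K = #J₂ := card_image_of_injective _ (image_injective (reflect_injective n))
  have hKs : #(∂ K) = #(∂ J₂) := by
    rw [hK, shadow_image (reflect_injective n),
      card_image_of_injective _ (image_injective (reflect_injective n))]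
  have hKsub : K ⊆ full d k n := fun A hA => by
    obtain ⟨B, hB, rfl⟩ := mem_image.1 hA
    exact image_reflect_mem_full (hsub₂ hB)
  have hlast : (range k).image (reflect n) ∈ K := mem_image_of_mem _ hfirst
  have hlast' : (range k).image (reflect n) ∉ J₁ := fun hmem => by
    refine hdone.1 (hsub₁.antisymm fun A hA => ?_)
    have hA' := mem_full.1 hA
    rcases (weight_le_image_reflect hA'.2.1 hA'.1).lt_or_eq with hlt | heq
    · exact hJ₁.down _ _ hmem hA'.2 hlt
    · rwa [weight_injective heq]
  have hlt : #(J₁ ∩ K) < #K := card_lt_card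
    ⟨inter_subset_right, fun hcon => hlast' (mem_inter.1 (hcon hlast)).1⟩
  have hU : J₁ ∪ K ⊆ full d k n := union_subset hsub₁ hKsub
  have hI : J₁ ∩ K ⊆ full d k n := inter_subset_left.trans hsub₁
  obtain ⟨M₁, M₂, hM₁, hM₂, hM₁s, hMc, hMs, hMl, hMd⟩ := ih #(J₁ ∩ K) (by omega)
    (G₁ := J₁ ∪ K) (G₂ := J₁ ∩ K) (fun A hA => (mem_full.1 (hU hA)).2)
    (fun A hA => (mem_full.1 (hI hA)).2) (card_le_card hU) (card_le_card hI) rfl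
  have hcard := card_union_add_card_inter J₁ K
  have hshadow : #(∂ (J₁ ∪ K)) + #(∂ (J₁ ∩ K)) ≤ #(∂ J₁) + #(∂ K) := by
    rw [← card_union_add_card_inter (∂ J₁) (∂ K)]
    refine Nat.add_le_add (card_le_card ?_) (card_le_card ?_)
    · intro A hA
      obtain ⟨B, hB, b, hb, rfl⟩ := mem_shadow_iff.1 hA
      rcases mem_union.1 hB with hB | hB
      · exact mem_union_left _ (erase_mem_shadow hB hb)
      · exact mem_union_right _ (erase_mem_shadow hB hb)
    · exact subset_inter (shadow_monotone inter_subset_left) (shadow_monotone inter_subset_right)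
  exact ⟨M₁, M₂, hM₁, hM₂, hM₁s, by omega, by omega, by omega, hMd⟩

/-! ### Omitting a color -/

/-- Rainbow sets avoiding the color `c`. -/
def RainbowAvoid (d k c : ℕ) (A : Finset ℕ) : Prop := Rainbow d k A ∧ ∀ a ∈ A, a % d ≠ c

/-- The increasing enumeration of the numbers that are not congruent to `c` modulo `d + 1`. -/
def skip (d c i : ℕ) : ℕ := i + (i + (d - c)) / d

lemma skip_strictMono (d c : ℕ) : StrictMono (skip d c) := by
  intro i j hij
  have : (i + (d - c)) / d ≤ (j + (d - c)) / d := Nat.div_le_div_right (by omega)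
  unfold skip
  omega

lemma skip_add (d c i : ℕ) :
    skip d c i + (d - c) = (d + 1) * ((i + (d - c)) / d) + (i + (d - c)) % d := by
  have := Nat.div_add_mod (i + (d - c)) d
  unfold skip
  rw [add_mul]
  omega

lemma skip_add_mod {d : ℕ} (hd : 0 < d) (c i : ℕ) :
    (skip d c i + (d - c)) % (d + 1) = (i + (d - c)) % d := by
  rw [skip_add, Nat.mul_add_mod, Nat.mod_eq_of_lt]
  exact (Nat.mod_lt _ hd).trans (Nat.lt_succ_self d)

lemma skip_mod_ne {d c : ℕ} (hd : 0 < d) (hc : c ≤ d) (i : ℕ) : skip d c i % (d + 1) ≠ c := by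
  intro h
  have h1 := skip_add_mod hd c i
  have h2 := Nat.mod_lt (i + (d - c)) hd
  rw [Nat.add_mod, h, Nat.mod_eq_of_lt (by omega : d - c < d + 1),
    Nat.mod_eq_of_lt (by omega)] at h1
  omega

lemma skip_mod_eq_iff {d : ℕ} (hd : 0 < d) (c i j : ℕ) :
    skip d c i % (d + 1) = skip d c j % (d + 1) ↔ i % d = j % d := by
  have h1 := skip_add_mod hd c i
  have h2 := skip_add_mod hd c j
  constructor
  · intro h
    have h3 : skip d c i + (d - c) ≡ skip d c j + (d - c) [MOD (d + 1)] := Nat.ModEq.add_right _ h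
    have h4 : i + (d - c) ≡ j + (d - c) [MOD d] := by
      unfold Nat.ModEq at h3 ⊢
      omega
    exact Nat.ModEq.add_right_cancel' _ h4
  · intro h
    have h3 : i + (d - c) ≡ j + (d - c) [MOD d] := Nat.ModEq.add_right _ h
    have h4 : skip d c i + (d - c) ≡ skip d c j + (d - c) [MOD (d + 1)] := by
      unfold Nat.ModEq at h3 ⊢
      omega
    exact Nat.ModEq.add_right_cancel' _ h4

lemma exists_skip_eq {d c n : ℕ} (hd : 0 < d) (hc : c ≤ d) (hn : n % (d + 1) ≠ c) :
    ∃ i, skip d c i = n := by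
  set q := (n + (d - c)) / (d + 1) with hq
  set r := (n + (d - c)) % (d + 1) with hr
  have hqr : (d + 1) * q + r = n + (d - c) := Nat.div_add_mod _ _
  have hrlt : r < d + 1 := Nat.mod_lt _ (Nat.succ_pos d)
  have hrd : r ≠ d := by
    intro h
    apply hn
    have h3 : n + (d - c) ≡ c + (d - c) [MOD (d + 1)] := by
      unfold Nat.ModEq
      rw [← hr, h, Nat.mod_eq_of_lt (by omega)]
      omega
    have h4 : n % (d + 1) = c % (d + 1) := Nat.ModEq.add_right_cancel' _ h3
    rwa [Nat.mod_eq_of_lt (by omega : c < d + 1)] at h4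
  have hge : d - c ≤ d * q + r := by
    rcases Nat.eq_zero_or_pos q with h | h
    · rw [h] at hqr ⊢
      omega
    · have : d * 1 ≤ d * q := Nat.mul_le_mul_left d h
      omega
  refine ⟨d * q + r - (d - c), ?_⟩
  unfold skip
  rw [Nat.sub_add_cancel hge, Nat.mul_add_div hd, Nat.div_eq_of_lt (by omega : r < d)]
  rw [add_mul] at hqr
  omega

lemma rainbowAvoid_image_iff {d k c : ℕ} (hd : 0 < d) (hc : c ≤ d) {A : Finset ℕ} :
    RainbowAvoid (d + 1) k c (A.image (skip d c)) ↔ Rainbow d k A := by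
  have hinj := (skip_strictMono d c).injective
  simp only [RainbowAvoid, Rainbow, card_image_of_injective _ hinj, forall_mem_image,
    skip_mod_eq_iff hd, hinj.eq_iff]
  exact ⟨fun h => h.1, fun h => ⟨h, fun a _ => skip_mod_ne hd hc a⟩⟩

lemma RainbowAvoid.exists_image {d k c : ℕ} (hd : 0 < d) (hc : c ≤ d) {A : Finset ℕ}
    (hA : RainbowAvoid (d + 1) k c A) : ∃ B, Rainbow d k B ∧ B.image (skip d c) = A := by
  classical
  have hinj := (skip_strictMono d c).injective
  have h : (A.preimage (skip d c) hinj.injOn).image (skip d c) = A := by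
    rw [image_preimage, filter_true_of_mem]
    intro a ha
    exact exists_skip_eq hd hc (hA.2 a ha)
  exact ⟨_, (rainbowAvoid_image_iff hd hc).1 (by rwa [h]), h⟩

lemma exists_image_skip {d k c : ℕ} (hd : 0 < d) (hc : c ≤ d) {F : Finset (Finset ℕ)}
    (hF : ∀ A ∈ F, RainbowAvoid (d + 1) k c A) :
    ∃ G : Finset (Finset ℕ), (∀ A ∈ G, Rainbow d k A) ∧ G.image (image (skip d c)) = F := by
  classical
  have hinj := image_injective (skip_strictMono d c).injective
  have h : (F.preimage (image (skip d c)) hinj.injOn).image (image (skip d c)) = F := by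
    rw [image_preimage, filter_true_of_mem]
    intro A hA
    obtain ⟨B, -, hB⟩ := (hF A hA).exists_image hd hc
    exact ⟨B, hB⟩
  refine ⟨_, fun A hA => ?_, h⟩
  exact (rainbowAvoid_image_iff hd hc).1 (hF _ (mem_preimage.1 hA))

lemma isInit_image_skip_iff {d k c : ℕ} (hd : 0 < d) (hc : c ≤ d) {J : Finset (Finset ℕ)} :
    IsInit (RainbowAvoid (d + 1) k c) (J.image (image (skip d c))) ↔ IsInit (Rainbow d k) J := by
  have hmono := skip_strictMono d c
  have hinj := image_injective hmono.injective
  constructor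
  · intro h
    refine ⟨fun A hA => (rainbowAvoid_image_iff hd hc).1 (h.prop _ (mem_image_of_mem _ hA)),
      fun A B hB hA hlt => ?_⟩
    exact (hinj.mem_finset_image).1 (h.down _ _ (mem_image_of_mem _ hB)
      ((rainbowAvoid_image_iff hd hc).2 hA) ((weight_image_lt hmono).2 hlt))
  · intro h
    refine ⟨fun A hA => ?_, fun A B hB hA hlt => ?_⟩
    · obtain ⟨A, hAJ, rfl⟩ := mem_image.1 hA
      exact (rainbowAvoid_image_iff hd hc).2 (h.prop A hAJ)
    · obtain ⟨B, hBJ, rfl⟩ := mem_image.1 hB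
      obtain ⟨A, hA', rfl⟩ := hA.exists_image hd hc
      exact mem_image_of_mem _ (h.down A B hBJ hA' ((weight_image_lt hmono).1 hlt))

lemma card_image_skip {d c : ℕ} (J : Finset (Finset ℕ)) :
    #(J.image (image (skip d c))) = #J :=
  card_image_of_injective _ (image_injective (skip_strictMono d c).injective)

lemma card_shadow_image_skip {d c : ℕ} (J : Finset (Finset ℕ)) :
    #(∂ (J.image (image (skip d c)))) = #(∂ J) := by
  rw [shadow_image (skip_strictMono d c).injective, card_image_skip]

lemma Minimizes.avoid {d k c : ℕ} (hd : 0 < d) (hc : c ≤ d) (h : Minimizes (Rainbow d k)) :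
    Minimizes (RainbowAvoid (d + 1) k c) := by
  intro F hF I hI hcard
  obtain ⟨G, hG, rfl⟩ := exists_image_skip hd hc hF
  obtain ⟨J, -, rfl⟩ := exists_image_skip hd hc hI.prop
  rw [card_image_skip, card_image_skip] at hcard
  rw [card_shadow_image_skip, card_shadow_image_skip]
  exact h G hG J ((isInit_image_skip_iff hd hc).1 hI) hcard

lemma IsInit.shadow_avoid {d k c : ℕ} (hd : 0 < d) (hc : c ≤ d) {I : Finset (Finset ℕ)}
    (hI : IsInit (RainbowAvoid (d + 1) (k + 1) c) I) :
    IsInit (RainbowAvoid (d + 1) k c) (∂ I) := by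
  obtain ⟨J, -, rfl⟩ := exists_image_skip hd hc hI.prop
  rw [shadow_image (skip_strictMono d c).injective]
  exact (isInit_image_skip_iff hd hc).2 (((isInit_image_skip_iff hd hc).1 hI).shadow hd)

/-! ### Compression with respect to a color class -/

lemma rainbowAvoid_shadow {d k c : ℕ} {F : Finset (Finset ℕ)}
    (hF : ∀ A ∈ F, RainbowAvoid d (k + 1) c A) : ∀ A ∈ ∂ F, RainbowAvoid d k c A := by
  intro A hA
  obtain ⟨B, hB, b, hb, rfl⟩ := mem_shadow_iff.1 hA
  exact ⟨(hF B hB).1.erase hb, fun a ha => (hF B hB).2 a (mem_of_mem_erase ha)⟩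

lemma avoids_of_rainbowAvoid {d k c : ℕ} {V : Finset ℕ} {F : Finset (Finset ℕ)}
    (hV : ∀ v ∈ V, v % d = c) (hF : ∀ A ∈ F, RainbowAvoid d k c A) : Avoids V F :=
  fun A hA v hv hvA => (hF A hA).2 v hvA (hV v hv)

lemma RainbowAvoid.insert {d k c v : ℕ} {A : Finset ℕ} (hA : RainbowAvoid d k c A)
    (hv : v % d = c) : Rainbow d (k + 1) (insert v A) :=
  hA.1.insert fun a ha => by rw [hv]; exact hA.2 a ha

lemma rainbow_of_mem_assemble {d k c : ℕ} {V : Finset ℕ} {D : Finset (Finset ℕ)}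
    {L : ℕ → Finset (Finset ℕ)} (hV : ∀ v ∈ V, v % d = c) (hD : ∀ A ∈ D, Rainbow d (k + 1) A)
    (hL : ∀ v ∈ V, ∀ A ∈ L v, RainbowAvoid d k c A) :
    ∀ A ∈ assemble D V L, Rainbow d (k + 1) A := by
  intro A hA
  rcases mem_assemble.1 hA with h | ⟨v, hv, B, hB, rfl⟩
  · exact hD A h
  · exact (hL v hv B hB).insert (hV v hv)

lemma Rainbow.avoid_of_insert {d k c v : ℕ} {A : Finset ℕ}
    (hA : Rainbow d (k + 1) (Insert.insert v A)) (hv : v % d = c) (hvA : v ∉ A) :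
    RainbowAvoid d k c A := by
  refine ⟨hA.of_insert hvA, fun a ha hac => hvA ?_⟩
  rwa [← hA.2 a (mem_insert_of_mem ha) v (mem_insert_self v A) (hac.trans hv.symm)]

/-- A family that is not initial among the sets through some vertex can be compressed. -/
lemma exists_sum_weight_lt {d k : ℕ} (hd : 0 < d) (h₁ : Minimizes (Rainbow d (k + 1)))
    (h₀ : Minimizes (Rainbow d k)) {F : Finset (Finset ℕ)}
    (hF : ∀ A ∈ F, Rainbow (d + 1) (k + 1) A) {A B : Finset ℕ} {v : ℕ} (hvA : v ∈ A) (hvB : v ∈ B)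
    (hB : B ∈ F) (hAF : A ∉ F) (hA : Rainbow (d + 1) (k + 1) A) (hlt : weight A < weight B) :
    ∃ F' : Finset (Finset ℕ), (∀ A ∈ F', Rainbow (d + 1) (k + 1) A) ∧ #F' = #F ∧
      #(∂ F') ≤ #(∂ F) ∧ ∑ A ∈ F', weight A < ∑ A ∈ F, weight A := by
  obtain ⟨c, hvc⟩ : ∃ c, v % (d + 1) = c := ⟨_, rfl⟩
  have hc : c ≤ d := Nat.lt_succ_iff.1 (hvc ▸ Nat.mod_lt v (Nat.succ_pos d))
  set V := (F.biUnion id).filter (· % (d + 1) = c) with hVdef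
  have hV : ∀ u ∈ V, u % (d + 1) = c := fun u hu => (mem_filter.1 hu).2
  have hmemV : ∀ A ∈ F, ∀ a ∈ A, a % (d + 1) = c → a ∈ V := fun A hA a ha hac =>
    mem_filter.2 ⟨mem_biUnion.2 ⟨A, hA, ha⟩, hac⟩
  have hvV : v ∈ V := hmemV B hB v hvB hvc
  set D := F.filter fun A => ∀ u ∈ V, u ∉ A with hDdef
  have hDp : ∀ A ∈ D, RainbowAvoid (d + 1) (k + 1) c A := fun A hA => by
    rw [hDdef, mem_filter] at hA
    exact ⟨hF A hA.1, fun a ha hac => hA.2 a (hmemV A hA.1 a ha hac) ha⟩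
  set L : ℕ → Finset (Finset ℕ) := fun u => F.memberSubfamily u with hLdef
  have hLp : ∀ u ∈ V, ∀ A ∈ L u, RainbowAvoid (d + 1) k c A := fun u hu A hA => by
    rw [hLdef, mem_memberSubfamily] at hA
    exact (hF _ hA.1).avoid_of_insert (hV u hu) hA.2
  have hFeq : assemble D V L = F := assemble_memberSubfamily D fun A => mem_filter
  have m₁ := h₁.avoid hd hc
  have m₀ := h₀.avoid hd hc
  obtain ⟨D', hD'i, hD'c, hD's⟩ := m₁.exists_isInit hDp
  choose! L' hL'i hL'c hL's using fun u (hu : u ∈ V) => m₀.exists_isInit (hLp u hu)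
  have hXp : ∀ A ∈ ∂ D ∪ V.biUnion L, RainbowAvoid (d + 1) k c A := fun A hA => by
    rcases mem_union.1 hA with hA | hA
    · exact rainbowAvoid_shadow hDp A hA
    · obtain ⟨u, hu, hA⟩ := mem_biUnion.1 hA
      exact hLp u hu A hA
  obtain ⟨X, hX, hXc⟩ := exists_isInit hXp le_rfl
  have hsub : ∂ D' ∪ V.biUnion L' ⊆ X := by
    refine union_subset ((hD'i.shadow_avoid hd hc).subset_of_card_le hX ?_)
      (biUnion_subset.2 fun u hu => (hL'i u hu).subset_of_card_le hX ?_)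
    · rw [hXc]
      exact hD's.trans (card_le_card subset_union_left)
    · rw [hXc, hL'c u hu]
      exact card_le_card ((subset_biUnion_of_mem L hu).trans subset_union_right)
  have aD := avoids_of_rainbowAvoid hV hDp
  have aL := fun u hu => avoids_of_rainbowAvoid hV (hLp u hu)
  have aD' := avoids_of_rainbowAvoid hV hD'i.prop
  have aL' := fun u hu => avoids_of_rainbowAvoid hV (hL'i u hu).prop
  refine ⟨assemble D' V L', rainbow_of_mem_assemble hV (fun A hA => (hD'i.prop A hA).1)
    (fun u hu => (hL'i u hu).prop), ?_, ?_, ?_⟩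
  · rw [← hFeq, card_assemble aD' aL', card_assemble aD aL, hD'c, sum_congr rfl hL'c]
  · rw [← hFeq, card_shadow_assemble aD' aL', card_shadow_assemble aD aL, ← hXc]
    exact Nat.add_le_add (card_le_card hsub) (sum_le_sum hL's)
  · rw [← hFeq, sum_assemble aD' aL', sum_assemble aD aL]
    have hsum : ∀ (M : ℕ → Finset (Finset ℕ)), (∀ u ∈ V, Avoids V (M u)) → ∀ u ∈ V,
        ∑ A ∈ M u, weight (insert u A) = #(M u) * 2 ^ u + ∑ A ∈ M u, weight A := by
      intro M hM u hu
      rw [sum_congr rfl fun A hA => weight_insert (hM u hu A hA u hu), sum_add_distrib, sum_const,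
        smul_eq_mul]
    refine Nat.add_lt_add_of_le_of_lt (hD'i.sum_weight_le hDp hD'c)
      (sum_lt_sum (fun u hu => ?_) ⟨v, hvV, ?_⟩)
    · rw [hsum L' aL' u hu, hsum L aL u hu, hL'c u hu]
      exact Nat.add_le_add_left ((hL'i u hu).sum_weight_le (hLp u hu) (hL'c u hu)) _
    · rw [hsum L' aL' v hvV, hsum L aL v hvV, hL'c v hvV]
      refine Nat.add_lt_add_left ((hL'i v hvV).sum_weight_lt (hLp v hvV) (hL'c v hvV) ?_) _
      intro heq
      have hBL : B.erase v ∈ L v := by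
        rw [hLdef, mem_memberSubfamily, insert_erase hvB]
        exact ⟨hB, notMem_erase v B⟩
      rw [← insert_erase hvA] at hA
      rw [← insert_erase hvA, ← insert_erase hvB, weight_insert (notMem_erase _ _),
        weight_insert (notMem_erase _ _)] at hlt
      have hAL : A.erase v ∈ L v := by
        rw [← heq] at hBL ⊢
        exact (hL'i v hvV).down _ _ hBL (hA.avoid_of_insert hvc (notMem_erase v A)) (by omega)
      rw [hLdef, mem_memberSubfamily, insert_erase hvA] at hAL
      exact hAF hAL.1

/-! ### Stable families -/

lemma rainbow_singleton (d v : ℕ) : Rainbow d 1 {v} :=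
  ⟨card_singleton v, fun x hx y hy _ => by rw [mem_singleton.1 hx, mem_singleton.1 hy]⟩

lemma mem_shadow_full {d k n : ℕ} {C : Finset ℕ} (hkd : k + 1 ≤ d) (hkn : k + 1 ≤ n)
    (hC : Rainbow d k C) (hn : ∀ a ∈ C, a < n) : C ∈ ∂ (full d (k + 1) n) := by
  obtain ⟨C', hCC', hC'sub, hC'⟩ := hC.exists_extension (rainbow_range hkd) k.le_succ
  refine mem_shadow_iff_exists_mem_card_add_one.2
    ⟨C', mem_full.2 ⟨fun a ha => ?_, hC'⟩, hCC', by rw [hC'.1, hC.1]⟩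
  rcases mem_union.1 (hC'sub ha) with h | h
  · exact hn a h
  · exact (mem_range.1 h).trans_le hkn

lemma StrictMono.exists_lt_iff {e : ℕ → ℕ} (he : StrictMono e) (n : ℕ) :
    ∃ x, ∀ i, e i < n ↔ i < x := by
  classical
  have hex : ∃ x, n ≤ e x := ⟨n, he.id_le n⟩
  refine ⟨Nat.find hex, fun i => ⟨fun h => ?_, fun h => not_le.1 (Nat.find_min hex h)⟩⟩
  exact he.lt_iff_lt.1 (h.trans_le (Nat.find_spec hex))

lemma skip_lt_of_skip_succ_lt {d p i : ℕ} (hd : 0 < d) (h : skip d ((p + 1) % (d + 1)) i < p) :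
    skip d (p % (d + 1)) i < p := by
  have hlt := Nat.mod_lt p (Nat.succ_pos d)
  have hne : skip d (p % (d + 1)) i ≠ p := fun heq =>
    skip_mod_ne hd (Nat.lt_succ_iff.1 hlt) i (congrArg (· % (d + 1)) heq)
  have hmod : (p + 1) % (d + 1) = (p % (d + 1) + 1) % (d + 1) := by simp
  rw [hmod] at h
  generalize p % (d + 1) = c at *
  by_cases hcd : c = d
  · subst hcd
    rw [Nat.mod_self] at h
    have : (i + (c - c)) / c ≤ (i + (c - 0)) / c := Nat.div_le_div_right (by omega)
    unfold skip at *
    omega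
  · rw [Nat.mod_eq_of_lt (by omega)] at h
    have : (i + (d - c)) / d ≤ (i + (d - (c + 1)) + d) / d := Nat.div_le_div_right (by omega)
    rw [Nat.add_div_right _ hd] at this
    unfold skip at *
    omega

lemma mem_of_stable {d k b : ℕ} (hk : 3 ≤ k) {F : Finset (Finset ℕ)}
    (hF : ∀ A ∈ F, Rainbow d k A)
    (hst : ∀ A B v, v ∈ A → v ∈ B → B ∈ F → Rainbow d k A → weight A < weight B → A ∈ F)
    {B : Finset ℕ} (hB : B ∈ F) (hbB : b + 1 ∈ B) (hmax : ∀ x ∈ B, x ≤ b + 1) {A : Finset ℕ}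
    (hA : Rainbow d k A) (hAb : ∀ a ∈ A, a < b) : A ∈ F := by
  have hBe : Rainbow d (k - 1) (B.erase (b + 1)) := by
    have := hF B hB
    rw [show k = k - 1 + 1 by omega] at this
    exact this.erase hbB
  obtain ⟨e, he, hec⟩ := (rainbow_singleton d b).exists_new_color hBe (by omega)
  have hX : Rainbow d 2 (insert e {b}) := (rainbow_singleton d b).insert hec
  obtain ⟨a, ha, hac⟩ := hX.exists_new_color hA (by omega)
  obtain ⟨C, hXC, hCX, hC⟩ := (hX.insert hac).exists_extension hA hk
  have hbC : b ∈ C := hXC (by simp)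
  have heC : e ∈ C := hXC (by simp)
  have haC : a ∈ C := hXC (by simp)
  have heb := mem_erase.1 he
  have hCb : ∀ x ∈ C, x < b + 1 := fun x hx => by
    have hxC := hCX hx
    simp only [mem_union, mem_insert, mem_singleton] at hxC
    have := hmax e heb.2
    rcases hxC with (rfl | rfl | rfl) | h
    · exact (hAb x ha).trans (Nat.lt_succ_self b)
    · omega
    · omega
    · exact (hAb x h).trans (Nat.lt_succ_self b)
  have hCF : C ∈ F :=
    hst C B e heC heb.2 hB hC ((weight_lt_two_pow hCb).trans_le (two_pow_le_weight hbB))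
  exact hst A C a ha haC hCF hA ((weight_lt_two_pow hAb).trans_le (two_pow_le_weight hbC))

lemma le_of_weight_lt {A B : Finset ℕ} {n : ℕ} (h : weight A < weight B) (hB : ∀ x ∈ B, x ≤ n) :
    ∀ x ∈ A, x ≤ n := fun x hx => by
  have h1 := weight_lt_two_pow (b := n + 1) fun x hx => Nat.lt_succ_of_le (hB x hx)
  have h2 := two_pow_le_weight hx
  exact Nat.lt_succ_iff.1 ((Nat.pow_lt_pow_iff_right (by omega)).1 (h2.trans_lt (h.trans h1)))

lemma weight_erase_lt {A B : Finset ℕ} {v : ℕ} (hA : v ∈ A) (hB : v ∉ B)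
    (h : weight A < weight (insert v B)) : weight (A.erase v) < weight B := by
  rw [← insert_erase hA, weight_insert (notMem_erase _ _), weight_insert hB] at h
  omega

lemma Rainbow.avoid_erase {d k c v : ℕ} {A : Finset ℕ} (hA : Rainbow d (k + 1) A) (hvA : v ∈ A)
    (hv : v % d = c) : RainbowAvoid d k c (A.erase v) :=
  Rainbow.avoid_of_insert (by rwa [insert_erase hvA]) hv (notMem_erase v A)

lemma isInit_assemble {d k p : ℕ} {I₁ I₂ : Finset (Finset ℕ)}
    (hI₁ : IsInit (RainbowAvoid d k (p % d)) I₁) (hI₂ : IsInit (RainbowAvoid d k ((p + 1) % d)) I₂)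
    (hp₁ : ∀ A ∈ I₁, ∀ a ∈ A, a < p) (hp₂ : ∀ A ∈ I₂, ∀ a ∈ A, a < p)
    (hor : I₂ = ∅ ∨ ∀ A, RainbowAvoid d k (p % d) A → (∀ a ∈ A, a < p) → A ∈ I₁) :
    IsInit (Rainbow d (k + 1))
      (assemble (full d (k + 1) p) {p, p + 1} fun u => if u = p then I₁ else I₂) := by
  have hmem : ∀ A, A ∈ assemble (full d (k + 1) p) {p, p + 1} (fun u => if u = p then I₁ else I₂) ↔
      A ∈ full d (k + 1) p ∨ (∃ B ∈ I₁, insert p B = A) ∨ ∃ B ∈ I₂, insert (p + 1) B = A := by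
    intro A
    simp [mem_assemble]
  refine ⟨fun A hA => ?_, fun A B hBF hA hlt => ?_⟩
  · rcases (hmem A).1 hA with h | ⟨B, hB, rfl⟩ | ⟨B, hB, rfl⟩
    · exact (mem_full.1 h).2
    · exact (hI₁.prop B hB).insert rfl
    · exact (hI₂.prop B hB).insert rfl
  · rw [hmem]
    have hsmall : (∀ x ∈ A, x ≤ p) → p ∉ A → A ∈ full d (k + 1) p := fun h hpA =>
      mem_full.2 ⟨fun a ha => (h a ha).lt_of_ne fun hap => hpA (hap ▸ ha), hA⟩
    rcases (hmem B).1 hBF with h | ⟨B, hB, rfl⟩ | ⟨B, hB, rfl⟩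
    · exact Or.inl ((isInit_full d (k + 1) p).down A B h hA hlt)
    · have hAp := le_of_weight_lt hlt (n := p) fun x hx => by
        rcases mem_insert.1 hx with rfl | hx
        · exact le_rfl
        · exact (hp₁ B hB x hx).le
      by_cases hpA : p ∈ A
      · exact Or.inr (Or.inl ⟨A.erase p, hI₁.down _ B hB (hA.avoid_erase hpA rfl)
          (weight_erase_lt hpA (fun h => lt_irrefl _ (hp₁ B hB p h)) hlt), insert_erase hpA⟩)
      · exact Or.inl (hsmall hAp hpA)
    · have hAp := le_of_weight_lt hlt (n := p + 1) fun x hx => by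
        rcases mem_insert.1 hx with rfl | hx
        · exact le_rfl
        · exact (hp₂ B hB x hx).le.trans p.le_succ
      by_cases hbA : p + 1 ∈ A
      · exact Or.inr (Or.inr ⟨A.erase (p + 1), hI₂.down _ B hB (hA.avoid_erase hbA rfl)
          (weight_erase_lt hbA (fun h => by have := hp₂ B hB _ h; omega) hlt), insert_erase hbA⟩)
      have hAp' : ∀ x ∈ A, x ≤ p := fun x hx =>
        Nat.lt_succ_iff.1 ((hAp x hx).lt_of_ne fun h => hbA (h ▸ hx))
      by_cases hpA : p ∈ A
      · have hI : ∀ A, RainbowAvoid d k (p % d) A → (∀ a ∈ A, a < p) → A ∈ I₁ :=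
          hor.resolve_left (ne_empty_of_mem hB)
        refine Or.inr (Or.inl ⟨A.erase p, hI _ (hA.avoid_erase hpA rfl) fun a ha => ?_,
          insert_erase hpA⟩)
        exact (hAp' a (mem_of_mem_erase ha)).lt_of_ne (ne_of_mem_erase ha)
      · exact Or.inl (hsmall hAp' hpA)

lemma exists_isInit_of_stable {d m : ℕ} (hd : 0 < d) (h : Minimizes (Rainbow d (m + 2)))
    {F : Finset (Finset ℕ)} (hF : ∀ A ∈ F, Rainbow (d + 1) (m + 3) A)
    (hst : ∀ A B v, v ∈ A → v ∈ B → B ∈ F → Rainbow (d + 1) (m + 3) A → weight A < weight B →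
      A ∈ F) :
    ∃ I, IsInit (Rainbow (d + 1) (m + 3)) I ∧ #I = #F ∧ #(∂ I) ≤ #(∂ F) := by
  by_cases hFi : IsInit (Rainbow (d + 1) (m + 3)) F
  · exact ⟨F, hFi, rfl, le_rfl⟩
  obtain ⟨B₁, hB₁⟩ : F.Nonempty := by
    rw [nonempty_iff_ne_empty]
    rintro rfl
    exact hFi ⟨hF, by simp⟩
  have hne : (F.biUnion id).Nonempty := by
    obtain ⟨x, hx⟩ : B₁.Nonempty := by
      rw [← card_pos, (hF B₁ hB₁).1]
      omega
    exact ⟨x, mem_biUnion.2 ⟨B₁, hB₁, hx⟩⟩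
  set b := (F.biUnion id).max' hne with hb
  obtain ⟨B, hB, hbB⟩ := mem_biUnion.1 ((F.biUnion id).max'_mem hne)
  rw [← hb, id] at hbB
  have hmax : ∀ A ∈ F, ∀ x ∈ A, x ≤ b := fun A hA x hx =>
    le_max' _ _ (mem_biUnion.2 ⟨A, hA, hx⟩)
  obtain ⟨A₀, hA₀, hA₀b, hA₀F⟩ : ∃ A, Rainbow (d + 1) (m + 3) A ∧ (∀ a ∈ A, a < b) ∧ A ∉ F := by
    by_contra! hcon
    refine hFi ⟨hF, fun A C hC hA hlt => ?_⟩
    by_cases hbA : b ∈ A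
    · by_cases hbC : b ∈ C
      · exact hst A C b hbA hbC hC hA hlt
      · have h1 := weight_lt_two_pow (b := b) fun x hx =>
          (hmax C hC x hx).lt_of_ne fun h => hbC (h ▸ hx)
        have h2 := two_pow_le_weight hbA
        omega
    · exact hcon A hA fun a ha =>
        (le_of_weight_lt hlt (hmax C hC) a ha).lt_of_ne fun h => hbA (h ▸ ha)
  have hdisj : ∀ C ∈ F, b ∈ C → Disjoint A₀ C := fun C hC hbC => by
    rw [disjoint_left]
    intro a ha haC
    exact hA₀F (hst A₀ C a ha haC hC hA₀
      ((weight_lt_two_pow hA₀b).trans_le (two_pow_le_weight hbC)))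
  have hcard : 2 * (m + 3) ≤ b + 1 := by
    have : A₀ ∪ B ⊆ range (b + 1) := union_subset
      (fun a ha => mem_range.2 ((hA₀b a ha).trans b.lt_succ_self))
      fun a ha => mem_range.2 (Nat.lt_succ_of_le (hmax B hB a ha))
    have := card_le_card this
    rw [card_union_of_disjoint (hdisj B hB hbB), hA₀.1, (hF B hB).1, card_range] at this
    omega
  clear_value b
  obtain ⟨p, rfl⟩ : ∃ p, b = p + 1 := ⟨b - 1, by omega⟩
  have hfull : ∀ A, Rainbow (d + 1) (m + 3) A → (∀ a ∈ A, a < p) → A ∈ F := fun A hA hAp =>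
    mem_of_stable (by omega) hF hst hB hbB (hmax B hB) hA hAp
  have hpA₀ : p ∈ A₀ := by
    by_contra hp
    exact hA₀F (hfull A₀ hA₀ fun a ha =>
      (Nat.lt_succ_iff.1 (hA₀b a ha)).lt_of_ne fun h => hp (h ▸ ha))
  have hpb : ∀ C ∈ F, p + 1 ∈ C → p ∉ C := fun C hC hbC =>
    disjoint_left.1 (hdisj C hC hbC) hpA₀
  set V : Finset ℕ := {p, p + 1} with hV
  set D := full (d + 1) (m + 3) p with hD
  set L : ℕ → Finset (Finset ℕ) := fun u => F.memberSubfamily u with hL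
  have hFeq : assemble D V L = F := by
    refine assemble_memberSubfamily D fun A => ?_
    simp only [hD, mem_full, hV, forall_mem_insert, mem_singleton, forall_eq]
    constructor
    · rintro ⟨hAp, hA⟩
      exact ⟨hfull A hA hAp, fun h => lt_irrefl _ (hAp _ h), fun h => by have := hAp _ h; omega⟩
    · rintro ⟨hA, hpA, hbA⟩
      refine ⟨fun a ha => ?_, hF A hA⟩
      have h1 := hmax A hA a ha
      have h2 : a ≠ p := fun h => hpA (h ▸ ha)
      have h3 : a ≠ p + 1 := fun h => hbA (h ▸ ha)
      omega
  have hLlt : ∀ u ∈ V, ∀ A ∈ L u, ∀ a ∈ A, a < p := fun u hu A hA a ha => by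
    rw [hL, mem_memberSubfamily] at hA
    have h1 := hmax _ hA.1 a (mem_insert_of_mem ha)
    have h2 : a ≠ u := fun h => hA.2 (h ▸ ha)
    have h3 := hpb _ hA.1
    rw [hV, mem_insert, mem_singleton] at hu
    by_contra hap
    rcases hu with rfl | rfl
    · have h4 : a = u + 1 := by omega
      exact h3 (mem_insert_of_mem (h4 ▸ ha)) (mem_insert_self _ _)
    · have h4 : a = p := by omega
      exact h3 (mem_insert_self _ _) (mem_insert_of_mem (h4 ▸ ha))
  have hLp : ∀ u ∈ V, ∀ A ∈ L u, RainbowAvoid (d + 1) (m + 2) (u % (d + 1)) A :=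
    fun u hu A hA => by
      rw [hL, mem_memberSubfamily] at hA
      exact (hF _ hA.1).avoid_of_insert rfl hA.2
  have avoids : ∀ {G : Finset (Finset ℕ)}, (∀ A ∈ G, ∀ a ∈ A, a < p) → Avoids V G := by
    intro G hG A hA v hv hvA
    have := hG A hA v hvA
    rw [hV, mem_insert, mem_singleton] at hv
    omega
  have aD : Avoids V D := avoids fun A hA => (mem_full.1 hA).1
  have aL := fun u hu => avoids (hLlt u hu)
  have hpV : p ∈ V := by simp [hV]
  have hbV : p + 1 ∈ V := by simp [hV]
  have hmod : ∀ u, u % (d + 1) ≤ d := fun u => Nat.lt_succ_iff.1 (Nat.mod_lt u d.succ_pos)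
  obtain ⟨G₁, hG₁, hG₁L⟩ := exists_image_skip hd (hmod p) (hLp p hpV)
  obtain ⟨G₂, hG₂, hG₂L⟩ := exists_image_skip hd (hmod (p + 1)) (hLp (p + 1) hbV)
  obtain ⟨x, hx⟩ := StrictMono.exists_lt_iff (skip_strictMono d (p % (d + 1))) p
  obtain ⟨y, hy⟩ := StrictMono.exists_lt_iff (skip_strictMono d ((p + 1) % (d + 1))) p
  have hyx : y ≤ x := by
    by_contra! hxy
    exact lt_irrefl x ((hx x).1 (skip_lt_of_skip_succ_lt hd ((hy x).2 hxy)))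
  have hG₁x : G₁ ⊆ full d (m + 2) x := fun A hA => mem_full.2 ⟨fun a ha => (hx a).1
    (hLlt p hpV _ (hG₁L ▸ mem_image_of_mem _ hA) _ (mem_image_of_mem _ ha)), hG₁ A hA⟩
  have hG₂y : G₂ ⊆ full d (m + 2) y := fun A hA => mem_full.2 ⟨fun a ha => (hy a).1
    (hLlt (p + 1) hbV _ (hG₂L ▸ mem_image_of_mem _ hA) _ (mem_image_of_mem _ ha)), hG₂ A hA⟩
  obtain ⟨J₁, J₂, hJ₁, hJ₂, hJ₁x, hJc, hJs, hJl, hor⟩ := h.exists_packing hd hG₁ hG₂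
    (card_le_card hG₁x) (card_le_card (hG₂y.trans (full_mono hyx)))
  have hJ₂y := hJ₂.subset_of_card_le (isInit_full d (m + 2) y) (hJl.trans (card_le_card hG₂y))
  set I₁ := J₁.image (image (skip d (p % (d + 1)))) with hI₁
  set I₂ := J₂.image (image (skip d ((p + 1) % (d + 1)))) with hI₂
  have hI₁p : ∀ A ∈ I₁, ∀ a ∈ A, a < p := by
    simp only [hI₁, forall_mem_image]
    exact fun A hA a ha => (hx a).2 ((mem_full.1 (hJ₁x hA)).1 a ha)
  have hI₂p : ∀ A ∈ I₂, ∀ a ∈ A, a < p := by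
    simp only [hI₂, forall_mem_image]
    exact fun A hA a ha => (hy a).2 ((mem_full.1 (hJ₂y hA)).1 a ha)
  have hI₁i := (isInit_image_skip_iff hd (hmod p)).2 hJ₁
  have hI₂i := (isInit_image_skip_iff hd (hmod (p + 1))).2 hJ₂
  rw [← hI₁] at hI₁i
  rw [← hI₂] at hI₂i
  have aL' : ∀ u ∈ V, Avoids V (if u = p then I₁ else I₂) := fun u _ => by
    split_ifs
    exacts [avoids hI₁p, avoids hI₂p]
  have hpp : p ≠ p + 1 := by omega
  have hkd := hA₀.le d.succ_pos
  refine ⟨_, isInit_assemble hI₁i hI₂i hI₁p hI₂p ?_, ?_, ?_⟩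
  · rcases hor with hor | hor
    · refine Or.inr fun A hA hAp => ?_
      obtain ⟨C, hC, rfl⟩ := hA.exists_image hd (hmod p)
      refine mem_image_of_mem _ (hor ▸ mem_full.2 ⟨fun a ha => (hx a).1 ?_, hC⟩)
      exact hAp _ (mem_image_of_mem _ ha)
    · exact Or.inl (by rw [hI₂, hor, image_empty])
  · rw [← hFeq, card_assemble aD aL', card_assemble aD aL, hV, sum_pair hpp, sum_pair hpp,
      if_pos rfl, if_neg hpp.symm, ← hG₁L, ← hG₂L, card_image_skip, card_image_skip,
      card_image_skip, card_image_skip, hJc]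
  · rw [← hFeq, card_shadow_assemble aD aL', card_shadow_assemble aD aL]
    refine Nat.add_le_add (card_le_card ?_) ?_
    · refine (union_subset Subset.rfl (biUnion_subset.2 fun u _ A hA => ?_)).trans
        subset_union_left
      split_ifs at hA
      · exact mem_shadow_full hkd (by omega) (hI₁i.prop A hA).1 (hI₁p A hA)
      · exact mem_shadow_full hkd (by omega) (hI₂i.prop A hA).1 (hI₂p A hA)
    · rw [hV, sum_pair hpp, sum_pair hpp, if_pos rfl, if_neg hpp.symm, ← hG₁L, ← hG₂L,
        card_shadow_image_skip, card_shadow_image_skip, card_shadow_image_skip,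
        card_shadow_image_skip]
      exact hJs

/-- The Frankl–Füredi–Kalai theorem: initial families of rainbow sets minimize the shadow. -/
theorem minimizes_rainbow {d : ℕ} (hd : 0 < d) (k : ℕ) : Minimizes (Rainbow d k) := by
  induction d, hd using Nat.le_induction generalizing k with
  | base =>
    match k with
    | 0 => exact minimizes_zero 1
    | 1 => exact minimizes_one 1
    | k + 2 =>
      intro F hF I hI _
      have : I = ∅ := eq_empty_of_forall_notMem fun A hA => by
        have := (hI.prop A hA).le one_pos
        omega
      rw [this, shadow_empty]
      exact Nat.zero_le _
  | succ d hd ih =>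
    match k with
    | 0 => exact minimizes_zero _
    | 1 => exact minimizes_one _
    | 2 => exact minimizes_two d.succ_pos
    | m + 3 =>
      refine minimizes_of_exists fun F hF => ?_
      induction hw : ∑ A ∈ F, weight A using Nat.strong_induction_on generalizing F with
      | _ w ihw =>
      by_cases hst : ∀ A B v, v ∈ A → v ∈ B → B ∈ F → Rainbow (d + 1) (m + 3) A →
          weight A < weight B → A ∈ F
      · exact exists_isInit_of_stable hd (ih _) hF hst
      · push Not at hst
        obtain ⟨A, B, v, hvA, hvB, hB, hA, hlt, hAF⟩ := hst
        obtain ⟨F', hF', hc, hs, hw'⟩ :=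
          exists_sum_weight_lt hd (ih _) (ih _) hF hvA hvB hB hAF hA hlt
        obtain ⟨I, hI, hIc, hIs⟩ := ihw _ (hw ▸ hw') F' hF' rfl
        exact ⟨I, hI, hIc.trans hc, hIs.trans hs⟩

/-! ### Cliques -/

section Cliques

variable {V : Type*} (G : SimpleGraph V)

open Classical in
/-- The `j`-cliques of `G` inside `W`. -/
noncomputable def cliques (W : Finset V) (j : ℕ) : Finset (Finset V) :=
  W.powerset.filter (G.IsNClique j)

open Classical in
/-- The neighbors of `u` inside `W`. -/
noncomputable def nbrs (W : Finset V) (u : V) : Finset V := W.filter (G.Adj u)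

variable {G}

lemma mem_cliques {W A : Finset V} {j : ℕ} : A ∈ cliques G W j ↔ A ⊆ W ∧ G.IsNClique j A := by
  classical
  rw [cliques, mem_filter, mem_powerset]

lemma mem_nbrs {W : Finset V} {u v : V} : v ∈ nbrs G W u ↔ v ∈ W ∧ G.Adj u v := by
  classical
  rw [nbrs, mem_filter]

lemma card_cliques_mono {W W' : Finset V} (h : W ⊆ W') (j : ℕ) :
    #(cliques G W j) ≤ #(cliques G W' j) :=
  card_le_card fun A hA => by
    rw [mem_cliques] at hA ⊢
    exact ⟨hA.1.trans h, hA.2⟩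

lemma nbrs_mono {W W' : Finset V} (h : W ⊆ W') (u : V) : nbrs G W u ⊆ nbrs G W' u := fun v hv => by
  rw [mem_nbrs] at hv ⊢
  exact ⟨h hv.1, hv.2⟩

lemma card_cliques_zero (W : Finset V) : #(cliques G W 0) = 1 := by
  rw [card_eq_one]
  refine ⟨∅, ext fun A => ?_⟩
  rw [mem_cliques, SimpleGraph.isNClique_iff, mem_singleton, card_eq_zero]
  constructor
  · exact fun h => h.2.2
  · rintro rfl
    simp

lemma cliques_eq_empty_of_le {W : Finset V} {i j : ℕ} (hij : i ≤ j) (h : cliques G W i = ∅) :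
    cliques G W j = ∅ := by
  refine eq_empty_of_forall_notMem fun A hA => ?_
  rw [mem_cliques] at hA
  obtain ⟨B, hBA, hB⟩ := exists_subset_card_eq (hij.trans_eq hA.2.card_eq.symm)
  refine notMem_empty B (h ▸ mem_cliques.2 ⟨hBA.trans hA.1, ?_, hB⟩)
  exact hA.2.isClique.subset (coe_subset.2 hBA)

lemma card_cliques_insert [DecidableEq V] {U : Finset V} {u : V} (hu : u ∉ U) (j : ℕ) :
    #(cliques G (insert u U) (j + 1)) = #(cliques G U (j + 1)) + #(cliques G (nbrs G U u) j) := by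
  rw [← card_memberSubfamily_add_card_nonMemberSubfamily u, add_comm]
  congr 2
  · ext A
    rw [mem_nonMemberSubfamily, mem_cliques, mem_cliques]
    constructor
    · rintro ⟨⟨h1, h2⟩, h3⟩
      exact ⟨(subset_insert_iff_of_notMem h3).1 h1, h2⟩
    · rintro ⟨h1, h2⟩
      exact ⟨⟨h1.trans (subset_insert u U), h2⟩, fun h => hu (h1 h)⟩
  · ext A
    rw [mem_memberSubfamily, mem_cliques, mem_cliques]
    constructor
    · rintro ⟨⟨h1, h2⟩, h3⟩
      have hc := h2.isClique
      rw [coe_insert, SimpleGraph.isClique_insert_of_notMem (by simpa using h3)] at hc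
      refine ⟨fun a ha => mem_nbrs.2 ⟨?_, hc.2 a ha⟩, hc.1, ?_⟩
      · exact (mem_insert.1 (h1 (mem_insert_of_mem ha))).resolve_left fun h => h3 (h ▸ ha)
      · have := h2.card_eq
        rw [card_insert_of_notMem h3] at this
        omega
    · rintro ⟨h1, h2⟩
      have h3 : u ∉ A := fun h => hu (mem_nbrs.1 (h1 h)).1
      refine ⟨⟨insert_subset_insert u fun a ha => (mem_nbrs.1 (h1 ha)).1, ?_⟩, h3⟩
      exact h2.insert fun a ha => (mem_nbrs.1 (h1 ha)).2

lemma cliques_nbrs_eq_empty {W : Finset V} {j : ℕ} (h : cliques G W (j + 1) = ∅) {u : V}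
    (hu : u ∈ W) : cliques G (nbrs G W u) j = ∅ := by
  classical
  refine eq_empty_of_forall_notMem fun A hA => ?_
  rw [mem_cliques] at hA
  refine notMem_empty (insert u A) (h ▸ mem_cliques.2 ⟨?_, ?_⟩)
  · exact insert_subset hu fun a ha => (mem_nbrs.1 (hA.1 ha)).1
  · exact hA.2.insert fun a ha => (mem_nbrs.1 (hA.1 ha)).2

lemma exists_isInit_rainbowAvoid {d k : ℕ} (hd : 0 < d) {W : Finset V}
    (h : ∃ F : Finset (Finset ℕ), (∀ A ∈ F, Rainbow d (k + 1) A) ∧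
      #F = #(cliques G W (k + 1)) ∧ #(∂ F) ≤ #(cliques G W k)) :
    ∃ I, IsInit (RainbowAvoid (d + 1) (k + 1) 0) I ∧ #I = #(cliques G W (k + 1)) ∧
      #(∂ I) ≤ #(cliques G W k) := by
  obtain ⟨F, hF, hc, hs⟩ := h
  obtain ⟨I, hI, hIc, hIs⟩ := (minimizes_rainbow hd (k + 1)).exists_isInit hF
  refine ⟨I.image (image (skip d 0)), (isInit_image_skip_iff hd d.zero_le).2 hI, ?_, ?_⟩
  · rw [card_image_skip, hIc, hc]
  · rw [card_shadow_image_skip]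
    exact hIs.trans hs

lemma exists_rainbow_succ {d k : ℕ} (hd : 0 < d) {W : Finset V}
    (ih : ∀ W : Finset V, cliques G W (d + 1) = ∅ → ∀ k, ∃ F : Finset (Finset ℕ),
      (∀ A ∈ F, Rainbow d (k + 1) A) ∧ #F = #(cliques G W (k + 1)) ∧ #(∂ F) ≤ #(cliques G W k))
    (hW : cliques G W (d + 2) = ∅) (hne : W.Nonempty) :
    ∃ F : Finset (Finset ℕ), (∀ A ∈ F, Rainbow (d + 1) (k + 2) A) ∧
      #F = #(cliques G W (k + 2)) ∧ #(∂ F) ≤ #(cliques G W (k + 1)) := by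
  classical
  obtain ⟨w, hw, hmax⟩ := exists_max_image W (fun u => #(cliques G (nbrs G W u) (k + 1))) hne
  set N := nbrs G W w with hN
  have hNW : N ⊆ W := fun v hv => (mem_nbrs.1 hv).1
  have hN0 := cliques_nbrs_eq_empty hW hw
  obtain ⟨D, hD, hDc, hDs⟩ := exists_isInit_rainbowAvoid hd (ih N hN0 (k + 1))
  obtain ⟨X, hX, hXc, -⟩ := exists_isInit_rainbowAvoid hd (ih N hN0 k)
  have key : ∀ S : Finset V, S ⊆ W → Disjoint S N → ∃ (T : Finset ℕ) (M : ℕ → Finset (Finset ℕ)),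
      (∀ t ∈ T, t % (d + 1) = 0) ∧ (∀ t ∈ T, ∀ A ∈ M t, RainbowAvoid (d + 1) (k + 1) 0 A) ∧
      (∀ t ∈ T, M t ⊆ X) ∧ #D + ∑ t ∈ T, #(M t) = #(cliques G (S ∪ N) (k + 2)) ∧
      #X + ∑ t ∈ T, #(∂ (M t)) ≤ #(cliques G (S ∪ N) (k + 1)) := by
    intro S
    induction S using Finset.induction with
    | empty =>
      intro _ _
      refine ⟨∅, fun _ => ∅, by simp, by simp, by simp, ?_, ?_⟩
      · simp [hDc]
      · simp [hXc]
    | insert u S huS ihS =>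
      intro hSW hSN
      rw [insert_subset_iff] at hSW
      rw [disjoint_insert_left] at hSN
      obtain ⟨T, M, hT, hM, hMX, hMc, hMs⟩ := ihS hSW.2 hSN.2
      have hsub : nbrs G (S ∪ N) u ⊆ nbrs G W u := nbrs_mono (union_subset hSW.2 hNW) u
      have hL0 : cliques G (nbrs G (S ∪ N) u) (d + 1) = ∅ := by
        rw [← card_eq_zero, ← Nat.le_zero]
        refine (card_cliques_mono hsub _).trans ?_
        rw [cliques_nbrs_eq_empty hW hSW.1, card_empty]
      obtain ⟨I, hI, hIc, hIs⟩ := exists_isInit_rainbowAvoid hd (ih _ hL0 k)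
      have hIX : I ⊆ X := hI.subset_of_card_le hX <| by
        rw [hIc, hXc]
        exact (card_cliques_mono hsub _).trans (hmax u hSW.1)
      obtain ⟨t, htT, ht⟩ : ∃ t, t ∉ T ∧ t % (d + 1) = 0 := by
        refine ⟨(d + 1) * (T.sup id + 1), fun h => ?_, Nat.mul_mod_right _ _⟩
        have h1 : (d + 1) * (T.sup id + 1) ≤ T.sup id := le_sup (f := id) h
        exact absurd ((Nat.le_mul_of_pos_left (T.sup id + 1) d.succ_pos).trans h1)
          (Nat.not_succ_le_self _)
      have hupd : ∀ s ∈ T, Function.update M t I s = M s := fun s hs =>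
        Function.update_of_ne (ne_of_mem_of_not_mem hs htT) _ _
      have huSN : u ∉ S ∪ N := by simp [huS, hSN.1]
      refine ⟨insert t T, Function.update M t I, ?_, ?_, ?_, ?_, ?_⟩
      · rw [forall_mem_insert]
        exact ⟨ht, hT⟩
      · rw [forall_mem_insert, Function.update_self]
        exact ⟨hI.prop, fun s hs => by rw [hupd s hs]; exact hM s hs⟩
      · rw [forall_mem_insert, Function.update_self]
        exact ⟨hIX, fun s hs => by rw [hupd s hs]; exact hMX s hs⟩
      · rw [sum_insert htT, Function.update_self, sum_congr rfl fun s hs => by rw [hupd s hs],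
          insert_union, card_cliques_insert huSN, hIc, ← hMc]
        omega
      · rw [sum_insert htT, Function.update_self, sum_congr rfl fun s hs => by rw [hupd s hs],
          insert_union, card_cliques_insert huSN]
        omega
  obtain ⟨T, M, hT, hM, hMX, hMc, hMs⟩ := key (W \ N) sdiff_subset sdiff_disjoint
  rw [sdiff_union_of_subset hNW] at hMc hMs
  have aD := avoids_of_rainbowAvoid hT hD.prop
  have aM := fun t ht => avoids_of_rainbowAvoid hT (hM t ht)
  refine ⟨assemble D T M, rainbow_of_mem_assemble hT (fun A hA => (hD.prop A hA).1) hM, ?_, ?_⟩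
  · rw [card_assemble aD aM, hMc]
  · rw [card_shadow_assemble aD aM]
    refine (Nat.add_le_add_right (card_le_card (union_subset ?_ (biUnion_subset.2 hMX))) _).trans
      hMs
    exact (hD.shadow_avoid hd d.zero_le).subset_of_card_le hX (hDs.trans_eq hXc.symm)

/-- The clique numbers of a graph without `(d + 1)`-cliques satisfy the colored Kruskal–Katona
inequalities. -/
theorem exists_rainbow {d : ℕ} (hd : 0 < d) {W : Finset V} (hW : cliques G W (d + 1) = ∅)
    (k : ℕ) : ∃ F : Finset (Finset ℕ), (∀ A ∈ F, Rainbow d (k + 1) A) ∧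
      #F = #(cliques G W (k + 1)) ∧ #(∂ F) ≤ #(cliques G W k) := by
  have hempty : ∀ {d k : ℕ} {W : Finset V}, cliques G W (k + 1) = ∅ →
      ∃ F : Finset (Finset ℕ), (∀ A ∈ F, Rainbow d (k + 1) A) ∧
        #F = #(cliques G W (k + 1)) ∧ #(∂ F) ≤ #(cliques G W k) := fun {d k W} h =>
    ⟨∅, by simp, by simp [h], by simp⟩
  have hzero : ∀ {d : ℕ} {W : Finset V},
      ∃ F : Finset (Finset ℕ), (∀ A ∈ F, Rainbow d 1 A) ∧
        #F = #(cliques G W 1) ∧ #(∂ F) ≤ #(cliques G W 0) := fun {d W} => by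
    have hF : ∀ A ∈ (range #(cliques G W 1)).image (fun i => ({i} : Finset ℕ)), Rainbow d 1 A := by
      simp only [forall_mem_image]
      exact fun i _ => rainbow_singleton d i
    refine ⟨_, hF, ?_, ?_⟩
    · rw [card_image_of_injective _ singleton_injective, card_range]
    · rw [card_cliques_zero, ← card_singleton (∅ : Finset ℕ)]
      refine card_le_card fun A hA => ?_
      rw [mem_singleton, ← card_eq_zero]
      exact (rainbow_shadow hF A hA).1
  induction d, hd using Nat.le_induction generalizing W k with
  | base =>
    match k with
    | 0 => exact hzero
    | k + 1 => exact hempty (cliques_eq_empty_of_le (by omega) hW)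
  | succ d hd ih =>
    match k with
    | 0 => exact hzero
    | k + 1 =>
      rcases W.eq_empty_or_nonempty with rfl | hne
      · refine hempty (eq_empty_of_forall_notMem fun A hA => ?_)
        rw [mem_cliques, subset_empty] at hA
        have := hA.2.card_eq
        rw [hA.1, card_empty] at this
        omega
      · exact exists_rainbow_succ hd (fun W hW k => ih hW k) hW hne

end Cliques

lemma mem_of_subset_of_shadow_subset {I : ℕ → Finset (Finset ℕ)} (hc : ∀ i, ∀ A ∈ I i, #A = i)
    (hI : ∀ i, ∂ (I (i + 1)) ⊆ I i) (i : ℕ) : ∀ A ∈ I i, ∀ B ⊆ A, B ∈ I #B := by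
  induction i with
  | zero =>
    intro A hA B hB
    have := card_eq_zero.1 (hc 0 A hA)
    subst this
    rw [subset_empty.1 hB]
    exact hA
  | succ i ih =>
    intro A hA B hB
    rcases hB.eq_or_ssubset with rfl | hss
    · rwa [hc _ B hA]
    · obtain ⟨a, ha, haB⟩ := exists_of_ssubset hss
      exact ih _ (hI i (erase_mem_shadow hA ha)) B (subset_erase.2 ⟨hB, haB⟩)

lemma ncard_cliqueSet {V : Type*} [Fintype V] (G : SimpleGraph V) (i : ℕ) :
    (G.cliqueSet i).ncard = #(cliques G univ i) := by
  rw [← Set.ncard_coe_finset]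
  congr 1
  ext A
  rw [mem_coe, mem_cliques, SimpleGraph.mem_cliqueSet_iff]
  simp

lemma exists_chain {V : Type*} [Fintype V] (G : SimpleGraph V) {d : ℕ} (hd : 0 < d)
    (hG : cliques G univ (d + 1) = ∅) :
    ∃ I : ℕ → Finset (Finset ℕ), (∀ i, ∀ A ∈ I i, Rainbow d i A) ∧ (∀ i, ∂ (I (i + 1)) ⊆ I i) ∧
      ∀ i, #(I i) = #(cliques G univ i) := by
  have hex : ∀ i, ∃ I, IsInit (Rainbow d i) I ∧ #I = #(cliques G univ i) := by
    intro i
    match i with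
    | 0 =>
      have hF : ∀ A ∈ ({∅} : Finset (Finset ℕ)), Rainbow d 0 A := by simp [Rainbow]
      obtain ⟨I, hI, hc⟩ := exists_isInit hF le_rfl
      exact ⟨I, hI, by rw [hc, card_cliques_zero, card_singleton]⟩
    | k + 1 =>
      obtain ⟨F, hF, hc, -⟩ := exists_rainbow hd hG k
      exact exists_isInit hF hc.ge
  choose I hI hc using hex
  refine ⟨I, fun i => (hI i).prop, fun i => ?_, hc⟩
  obtain ⟨F, hF, hFc, hFs⟩ := exists_rainbow hd hG i
  refine ((hI (i + 1)).shadow hd).subset_of_card_le (hI i) ?_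
  rw [hc i]
  exact (minimizes_rainbow hd _ F hF _ (hI (i + 1)) ((hc _).trans hFc.symm)).trans hFs

end FlagBalanced

open FlagBalanced

/-- Let `Δ` be a flag complex of dimension `d-1`, i.e. the clique complex of
a finite simple graph `G` whose largest clique has `d` vertices.  Then there exist a (finite)
simplicial complex `Γ` — a family of finite sets closed under taking subsets — together with
an assignment of one of `d` colors to each vertex such that no two vertices of the same color
lie in a common face of `Γ`, and for every `i ≥ 0` the number of faces of `Γ` on `i` vertices
equals the number of faces of `Δ` on `i` vertices (i.e. the number of `i`-cliques of `G`). -/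
theorem stmt_9 {V : Type} [Fintype V] (G : SimpleGraph V) (d : ℕ)
    (htop : (G.cliqueSet d).Nonempty) (hfree : G.CliqueFree (d + 1)) :
    ∃ (W : Type) (_ : Fintype W) (Γ : Set (Finset W)) (c : W → Fin d),
      (∀ t ∈ Γ, ∀ s ⊆ t, s ∈ Γ) ∧
      (∀ t ∈ Γ, ∀ x ∈ t, ∀ y ∈ t, c x = c y → x = y) ∧
      (∀ i : ℕ, {t ∈ Γ | t.card = i}.ncard = (G.cliqueSet i).ncard) := by
  have hempty : cliques G Finset.univ (d + 1) = ∅ :=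
    Finset.eq_empty_of_forall_notMem fun A hA => hfree A (mem_cliques.1 hA).2
  simp only [ncard_cliqueSet]
  rcases Nat.eq_zero_or_pos d with rfl | hd
  · refine ⟨Empty, inferInstance, {∅}, Empty.elim, ?_, fun t ht x => x.elim, fun i => ?_⟩
    · rintro t rfl s hs
      exact Finset.subset_empty.1 hs
    · rcases Nat.eq_zero_or_pos i with rfl | hi
      · rw [card_cliques_zero, Set.ncard_eq_one]
        refine ⟨∅, Set.ext fun t => ?_⟩
        simp
      · rw [cliques_eq_empty_of_le hi hempty, Finset.card_empty, Set.ncard_eq_zero]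
        refine Set.eq_empty_of_forall_notMem ?_
        rintro t ⟨rfl, ht⟩
        rw [Finset.card_empty] at ht
        omega
  · obtain ⟨I, hI, hs, hc⟩ := exists_chain G hd hempty
    have hlarge : ∀ i, ∀ A ∈ I i, i ∈ Finset.range (Fintype.card V + 1) := by
      intro i A hA
      have hpos : 0 < (cliques G Finset.univ i).card := by
        rw [← hc i]
        exact Finset.card_pos.2 ⟨A, hA⟩
      obtain ⟨B, hB⟩ := Finset.card_pos.1 hpos
      rw [Finset.mem_range, Nat.lt_succ_iff, ← (mem_cliques.1 hB).2.card_eq]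
      exact Finset.card_le_univ B
    obtain ⟨N, hN⟩ : ∃ N, ∀ i, ∀ A ∈ I i, ∀ a ∈ A, a < N := by
      refine ⟨(((Finset.range (Fintype.card V + 1)).biUnion I).biUnion id).sup id + 1,
        fun i A hA a ha => Nat.lt_succ_of_le (Finset.le_sup (f := id) ?_)⟩
      exact Finset.mem_biUnion.2 ⟨A, Finset.mem_biUnion.2 ⟨i, hlarge i A hA, hA⟩, ha⟩
    refine ⟨Fin N, inferInstance, {t | t.map Fin.valEmbedding ∈ I t.card},
      fun x => ⟨x % d, Nat.mod_lt _ hd⟩, fun t ht s hst => ?_, fun t ht x hx y hy hxy => ?_,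
      fun i => ?_⟩
    · have := mem_of_subset_of_shadow_subset (fun i A hA => (hI i A hA).1) hs _ _ ht _
        (Finset.map_subset_map.2 hst)
      rwa [Finset.card_map] at this
    · exact Fin.ext ((hI _ _ ht).2 x (Finset.mem_map_of_mem Fin.valEmbedding hx) y
        (Finset.mem_map_of_mem Fin.valEmbedding hy) (congrArg Fin.val hxy))
    · rw [← hc i, ← Set.ncard_coe_finset,
        ← Set.ncard_image_of_injective _ (Finset.map_injective Fin.valEmbedding)]
      congr 1
      ext A
      constructor
      · rintro ⟨t, ⟨ht, rfl⟩, rfl⟩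
        exact ht
      · intro hA
        have hmap : (A.attachFin (hN i A hA)).map Fin.valEmbedding = A :=
          Finset.map_valEmbedding_attachFin _
        refine ⟨A.attachFin (hN i A hA), ⟨?_, ?_⟩, hmap⟩
        · rw [Set.mem_ofPred_eq, hmap, Finset.card_attachFin, (hI i A hA).1]
          exact hA
        · rw [Finset.card_attachFin, (hI i A hA).1]
end
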